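/- arXiv:2410.21114 — 3 statements merged into one kernel-verified Lean document; each statement's English description precedes it below -/
import Mathlib

section
/- (New formula for entropy solutions — existence part of the main theorem.) The function u(x,t) := u⁺(x,t) is a weak solution of the Cauchy problem u_t + f(u)_x = 0, u|_{t=0} = φ, in the following sense: (i) for every function ϕ : ℝ × ℝ → ℝ that is infinitely differentiable and has compact support contained in ℝ × (0,∞), one has ∫∫_{ℝ×(0,∞)} ( u(x,t)·∂ₜϕ(x,t) + f(u(x,t))·∂ₓϕ(x,t) ) dx dt = 0; and (ii) for all x₁, x₂ ∈ ℝ, lim_{t→0⁺} ∫_{x₁}^{x₂} u(x,t) dx = ∫_{x₁}^{x₂} φ(x) dx (signed interval integrals). -/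
open MeasureTheory Filter Set

noncomputable def eFun (f φ : ℝ → ℝ) (u x t : ℝ) : ℝ :=
  t * (∫ s in (0:ℝ)..u, deriv (deriv f) s * (φ (x - t * deriv f s) - s))

def maxSet (f φ : ℝ → ℝ) (x t : ℝ) : Set ℝ :=
  {w : ℝ | ∀ v : ℝ, eFun f φ v x t ≤ eFun f φ w x t}

noncomputable def uPlus (f φ : ℝ → ℝ) (x t : ℝ) : ℝ := sInf (maxSet f φ x t)

noncomputable def uMinus (f φ : ℝ → ℝ) (x t : ℝ) : ℝ := sSup (maxSet f φ x t)

/-- A primitive of the initial datum. -/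
noncomputable def potential (φ : ℝ → ℝ) (x : ℝ) : ℝ := ∫ s in (0:ℝ)..x, φ s

/-- The cost, at the point `p = (x, t)`, of the straight characteristic carrying the value `v`. -/
noncomputable def hopfCost (f φ : ℝ → ℝ) (v : ℝ) (p : ℝ × ℝ) : ℝ :=
  potential φ (p.1 - p.2 * deriv f v) + p.2 * (v * deriv f v - f v)

/-- The Hopf–Lax value function, minimizing the cost over the speeds carried by `[-M, M]`. -/
noncomputable def hopfValue (f φ : ℝ → ℝ) (M : ℝ) (p : ℝ × ℝ) : ℝ :=
  sInf ((fun v => hopfCost f φ v p) '' Icc (-M) M)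

theorem strictMono_deriv_of_null {f : ℝ → ℝ} (hf : ContDiff ℝ 2 f)
    (hconv : ∀ u : ℝ, 0 ≤ deriv (deriv f) u)
    (hdeg : volume {u : ℝ | deriv (deriv f) u = 0} = 0) : StrictMono (deriv f) := by
  have hd : Differentiable ℝ (deriv f) :=
    ((contDiff_succ_iff_deriv (n := 1)).1 hf).2.2.differentiable one_ne_zero
  have hm : Monotone (deriv f) := monotone_of_deriv_nonneg hd hconv
  refine hm.strictMono_of_injective fun a b hab => ?_
  wlog h : a < b generalizing a b
  · rcases (not_lt.1 h).eq_or_lt with h | h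
    · exact h.symm
    · exact (this b a hab.symm h).symm
  exfalso
  have hsub : Ioo a b ⊆ {u : ℝ | deriv (deriv f) u = 0} := by
    intro u hu
    have : deriv f =ᶠ[nhds u] fun _ => deriv f a := by
      filter_upwards [Ioo_mem_nhds hu.1 hu.2] with y hy
      exact le_antisymm ((hm hy.2.le).trans hab.ge) (hm hy.1.le)
    simpa using this.deriv_eq
  have := measure_mono_null hsub hdeg
  rw [Real.volume_Ioo, ENNReal.ofReal_eq_zero] at this
  linarith

theorem tangent_le {f : ℝ → ℝ} (hf : ContDiff ℝ 2 f) (hm : Monotone (deriv f)) (a b : ℝ) :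
    f a + deriv f a * (b - a) ≤ f b := by
  have hd : Differentiable ℝ f := hf.differentiable two_ne_zero
  have hc := hm.convexOn_univ_of_deriv hd
  rcases lt_trichotomy a b with h | rfl | h
  · have := hc.deriv_le_slope (mem_univ a) (mem_univ b) h (hd a)
    rw [slope_def_field, le_div_iff₀ (by linarith)] at this
    linarith
  · simp
  · have := hc.slope_le_deriv (mem_univ b) (mem_univ a) h (hd a)
    rw [slope_def_field, div_le_iff₀ (by linarith)] at this
    linarith

theorem intervalIntegrable_of_bounded {φ : ℝ → ℝ} {M : ℝ} (hφ : Measurable φ)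
    (hb : ∀ x, |φ x| ≤ M) (a b : ℝ) : IntervalIntegrable φ volume a b :=
  (intervalIntegrable_const (c := M)).mono_fun hφ.aestronglyMeasurable
    (Eventually.of_forall fun x => (hb x).trans (le_abs_self M))

theorem potential_sub {φ : ℝ → ℝ} {M : ℝ} (hφ : Measurable φ)
    (hb : ∀ x, |φ x| ≤ M) (a b : ℝ) : potential φ b - potential φ a = ∫ s in a..b, φ s :=
  intervalIntegral.integral_interval_sub_left (intervalIntegrable_of_bounded hφ hb 0 b)
    (intervalIntegrable_of_bounded hφ hb 0 a)

theorem abs_potential_sub_le {φ : ℝ → ℝ} {M : ℝ} (hφ : Measurable φ)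
    (hb : ∀ x, |φ x| ≤ M) (a b : ℝ) : |potential φ b - potential φ a| ≤ M * |b - a| := by
  rw [potential_sub hφ hb]
  exact intervalIntegral.norm_integral_le_of_norm_le_const (f := φ) fun x _ => hb x

theorem integral_deriv_mul_comp {f φ : ℝ → ℝ} {M : ℝ} (hf : ContDiff ℝ 2 f)
    (hconv : ∀ u : ℝ, 0 ≤ deriv (deriv f) u) (hφ : Measurable φ) (hb : ∀ x, |φ x| ≤ M)
    (x : ℝ) {t : ℝ} (ht : 0 ≤ t) (a b : ℝ) :
    t * ∫ s in a..b, deriv (deriv f) s * φ (x - t * deriv f s) =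
      potential φ (x - t * deriv f a) - potential φ (x - t * deriv f b) := by
  wlog h : a ≤ b generalizing a b
  · rw [intervalIntegral.integral_symm, mul_neg, this b a (le_of_not_ge h)]
    ring
  have hd : Differentiable ℝ (deriv f) :=
    ((contDiff_succ_iff_deriv (n := 1)).1 hf).2.2.differentiable one_ne_zero
  have hm : Monotone (deriv f) := monotone_of_deriv_nonneg hd hconv
  have key := integral_Icc_deriv_smul_of_deriv_nonpos (f := fun s => x - t * deriv f s)
    (f' := fun s => -(t * deriv (deriv f) s)) (g := φ) (a := a) (b := b)
    (by have := hd.continuous; fun_prop)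
    (fun s _ => ((hd s).hasDerivAt.const_mul t).const_sub x)
    (fun s _ => neg_nonpos.2 (mul_nonneg ht (hconv s))) h
  have hle : x - t * deriv f b ≤ x - t * deriv f a := by
    have := mul_le_mul_of_nonneg_left (hm h) ht
    linarith
  rw [integral_Icc_eq_integral_Ioc, integral_Icc_eq_integral_Ioc,
    ← intervalIntegral.integral_of_le h, ← intervalIntegral.integral_of_le hle,
    ← potential_sub hφ hb] at key
  simp only [smul_eq_mul, neg_mul, intervalIntegral.integral_neg, mul_assoc,
    intervalIntegral.integral_const_mul] at key
  linarith

theorem eFun_eq {f φ : ℝ → ℝ} {M : ℝ} (hf : ContDiff ℝ 2 f)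
    (hconv : ∀ u : ℝ, 0 ≤ deriv (deriv f) u) (hφ : Measurable φ) (hb : ∀ x, |φ x| ≤ M)
    (u x : ℝ) {t : ℝ} (ht : 0 ≤ t) :
    eFun f φ u x t = hopfCost f φ 0 (x, t) - hopfCost f φ u (x, t) := by
  have hd1 : Differentiable ℝ f := hf.differentiable two_ne_zero
  have hf1 : ContDiff ℝ 1 (deriv f) := ((contDiff_succ_iff_deriv (n := 1)).1 hf).2.2
  have hd : Differentiable ℝ (deriv f) := hf1.differentiable one_ne_zero
  have hc : Continuous (deriv (deriv f)) := hf1.continuous_deriv le_rfl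
  have hi1 : IntervalIntegrable (fun s => deriv (deriv f) s * φ (x - t * deriv f s))
      volume 0 u :=
    (intervalIntegrable_of_bounded (hφ.comp (by have := hd.continuous.measurable; fun_prop))
      (fun s => hb _) 0 u).continuousOn_mul hc.continuousOn
  have hi2 : IntervalIntegrable (fun s => deriv (deriv f) s * s) volume 0 u :=
    (hc.mul continuous_id).intervalIntegrable 0 u
  have hint : ∫ s in (0:ℝ)..u, deriv (deriv f) s * s
      = (u * deriv f u - f u) - (0 * deriv f 0 - f 0) := by
    refine intervalIntegral.integral_eq_sub_of_hasDerivAt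
      (f := fun s => s * deriv f s - f s) (fun s _ => ?_) hi2
    convert! ((hasDerivAt_id s).mul (hd s).hasDerivAt).sub (hd1 s).hasDerivAt using 1
    simp only [id]
    ring
  unfold eFun
  simp only [mul_sub]
  rw [intervalIntegral.integral_sub hi1 hi2, mul_sub,
    integral_deriv_mul_comp hf hconv hφ hb x ht, hint]
  simp only [hopfCost]
  ring

theorem mem_maxSet_iff {f φ : ℝ → ℝ} {M : ℝ} (hf : ContDiff ℝ 2 f)
    (hconv : ∀ u : ℝ, 0 ≤ deriv (deriv f) u) (hφ : Measurable φ) (hb : ∀ x, |φ x| ≤ M)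
    (w x : ℝ) {t : ℝ} (ht : 0 ≤ t) :
    w ∈ maxSet f φ x t ↔ ∀ v, hopfCost f φ w (x, t) ≤ hopfCost f φ v (x, t) := by
  simp only [maxSet, mem_ofPred_eq, eFun_eq hf hconv hφ hb _ x ht, sub_le_sub_iff_left]

theorem exists_isLeast_hopfValue {f φ : ℝ → ℝ} {M : ℝ} (hf : ContDiff ℝ 2 f)
    (hφ : Measurable φ) (hb : ∀ x, |φ x| ≤ M) (p : ℝ × ℝ) :
    ∃ w ∈ Icc (-M) M, hopfValue f φ M p = hopfCost f φ w p ∧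
      ∀ v ∈ Icc (-M) M, hopfValue f φ M p ≤ hopfCost f φ v p := by
  have hM : 0 ≤ M := (abs_nonneg _).trans (hb 0)
  have hcf : Continuous f := hf.continuous
  have hcd : Continuous (deriv f) := hf.continuous_deriv one_le_two
  have hcp : Continuous (potential φ) :=
    intervalIntegral.continuous_primitive (intervalIntegrable_of_bounded hφ hb) 0
  have hc : Continuous fun v => hopfCost f φ v p := by
    unfold hopfCost
    fun_prop
  obtain ⟨w, hw, hmin, hle⟩ := isCompact_Icc.exists_sInf_image_eq_and_le
    (nonempty_Icc.2 (by linarith : -M ≤ M)) hc.continuousOn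
  exact ⟨w, hw, hmin, fun v hv => hmin.trans_le (hle v hv)⟩

theorem hopfValue_le {f φ : ℝ → ℝ} {M : ℝ} (hf : ContDiff ℝ 2 f) (hm : Monotone (deriv f))
    (hφ : Measurable φ) (hb : ∀ x, |φ x| ≤ M) {p : ℝ × ℝ} (hp : 0 ≤ p.2) (v : ℝ) :
    hopfValue f φ M p ≤ hopfCost f φ v p := by
  have hM : 0 ≤ M := (abs_nonneg _).trans (hb 0)
  obtain ⟨-, -, -, hle⟩ := exists_isLeast_hopfValue hf hφ hb p
  have hpot := fun c => abs_potential_sub_le hφ hb (p.1 - p.2 * deriv f v) (p.1 - p.2 * deriv f c)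
  have heq : ∀ c, p.1 - p.2 * deriv f c - (p.1 - p.2 * deriv f v)
      = p.2 * (deriv f v - deriv f c) := fun c => by ring
  rcases lt_or_ge v (-M) with hv | hv
  · refine (hle (-M) ⟨le_rfl, by linarith⟩).trans ?_
    have h1 := le_of_abs_le (hpot (-M))
    rw [heq, abs_of_nonpos
      (mul_nonpos_of_nonneg_of_nonpos hp (sub_nonpos.2 (hm hv.le)))] at h1
    have h2 := mul_le_mul_of_nonneg_left (tangent_le hf hm v (-M)) hp
    simp only [hopfCost]
    linarith
  rcases lt_or_ge M v with hv' | hv'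
  · refine (hle M ⟨by linarith, le_rfl⟩).trans ?_
    have h1 := le_of_abs_le (hpot M)
    rw [heq, abs_of_nonneg (mul_nonneg hp (sub_nonneg.2 (hm hv'.le)))] at h1
    have h2 := mul_le_mul_of_nonneg_left (tangent_le hf hm v M) hp
    simp only [hopfCost]
    linarith
  · exact hle v ⟨hv, hv'⟩

theorem hopfValue_eq_of_mem_maxSet {f φ : ℝ → ℝ} {M : ℝ} (hf : ContDiff ℝ 2 f)
    (hconv : ∀ u : ℝ, 0 ≤ deriv (deriv f) u) (hm : Monotone (deriv f)) (hφ : Measurable φ)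
    (hb : ∀ x, |φ x| ≤ M) {w x t : ℝ} (ht : 0 ≤ t) (hw : w ∈ maxSet f φ x t) :
    hopfValue f φ M (x, t) = hopfCost f φ w (x, t) := by
  obtain ⟨c, -, hc, -⟩ := exists_isLeast_hopfValue hf hφ hb (x, t)
  exact le_antisymm (hopfValue_le hf hm hφ hb ht w)
    (hc ▸ (mem_maxSet_iff hf hconv hφ hb w x ht).1 hw c)

theorem maxSet_nonempty {f φ : ℝ → ℝ} {M : ℝ} (hf : ContDiff ℝ 2 f)
    (hconv : ∀ u : ℝ, 0 ≤ deriv (deriv f) u) (hm : Monotone (deriv f)) (hφ : Measurable φ)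
    (hb : ∀ x, |φ x| ≤ M) (x : ℝ) {t : ℝ} (ht : 0 ≤ t) : (maxSet f φ x t).Nonempty := by
  obtain ⟨c, -, hc, -⟩ := exists_isLeast_hopfValue hf hφ hb (x, t)
  exact ⟨c, (mem_maxSet_iff hf hconv hφ hb c x ht).2 fun v =>
    hc ▸ hopfValue_le hf hm hφ hb ht v⟩

theorem exists_lipschitzWith_hopfValue {f φ : ℝ → ℝ} {M : ℝ} (hf : ContDiff ℝ 2 f)
    (hφ : Measurable φ) (hb : ∀ x, |φ x| ≤ M) :
    ∃ C, LipschitzWith C (hopfValue f φ M) := by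
  have hM : 0 ≤ M := (abs_nonneg _).trans (hb 0)
  have hcf : Continuous f := hf.continuous
  have hcd : Continuous (deriv f) := hf.continuous_deriv one_le_two
  obtain ⟨A, hA⟩ := (isCompact_Icc (a := -M) (b := M)).exists_bound_of_continuousOn
    hcd.continuousOn
  obtain ⟨B, hB⟩ := (isCompact_Icc (a := -M) (b := M)).exists_bound_of_continuousOn
    (f := fun v => v * deriv f v - f v) (by fun_prop)
  refine ⟨_, LipschitzWith.of_le_add_mul' (M * (1 + A) + B) fun p q => ?_⟩
  obtain ⟨w, hw, hq, -⟩ := exists_isLeast_hopfValue hf hφ hb q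
  obtain ⟨-, -, -, hp⟩ := exists_isLeast_hopfValue hf hφ hb p
  refine (hp w hw).trans ?_
  rw [hq]
  have hA' : |deriv f w| ≤ A := hA w hw
  have hB' : |w * deriv f w - f w| ≤ B := hB w hw
  have h1 : |p.1 - q.1| ≤ dist p q := le_max_left (dist p.1 q.1) (dist p.2 q.2)
  have h2 : |p.2 - q.2| ≤ dist p q := le_max_right (dist p.1 q.1) (dist p.2 q.2)
  have h3 : |(p.1 - p.2 * deriv f w) - (q.1 - q.2 * deriv f w)| ≤ (1 + A) * dist p q := by
    calc _ = |(p.1 - q.1) - (p.2 - q.2) * deriv f w| := by ring_nf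
      _ ≤ |p.1 - q.1| + |p.2 - q.2| * |deriv f w| := by
        rw [← abs_mul]
        exact abs_sub _ _
      _ ≤ dist p q + dist p q * A := by gcongr
      _ = _ := by ring
  have h4 := (le_of_abs_le (abs_potential_sub_le hφ hb (q.1 - q.2 * deriv f w)
    (p.1 - p.2 * deriv f w))).trans (mul_le_mul_of_nonneg_left h3 hM)
  have h5 : (p.2 - q.2) * (w * deriv f w - f w) ≤ dist p q * B :=
    (le_abs_self _).trans (by rw [abs_mul]; gcongr)
  simp only [hopfCost]
  linarith

theorem hopfValue_zero {f φ : ℝ → ℝ} {M : ℝ} (hf : ContDiff ℝ 2 f)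
    (hφ : Measurable φ) (hb : ∀ x, |φ x| ≤ M) (x : ℝ) :
    hopfValue f φ M (x, 0) = potential φ x := by
  obtain ⟨w, -, hw, -⟩ := exists_isLeast_hopfValue hf hφ hb (x, 0)
  simpa [hopfCost] using hw

/-- Wherever the value function is differentiable in space, its derivative is the unique
maximizer. -/
theorem eq_of_hasDerivAt_hopfValue {f φ : ℝ → ℝ} {M : ℝ} (hf : ContDiff ℝ 2 f)
    (hconv : ∀ u : ℝ, 0 ≤ deriv (deriv f) u) (hm : StrictMono (deriv f)) (hφ : Measurable φ)
    (hb : ∀ x, |φ x| ≤ M) {w x t d : ℝ} (ht : 0 < t) (hw : w ∈ maxSet f φ x t)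
    (hd : HasDerivAt (fun y => hopfValue f φ M (y, t)) d x) : w = d := by
  have hcd : Continuous (deriv f) := hf.continuous_deriv one_le_two
  set y : ℝ → ℝ := fun v => x + t * (deriv f v - deriv f w) with hy
  have hycont : Continuous y := by fun_prop
  have hyw : y w = x := by simp [hy]
  have hymono : StrictMono y := fun a b hab =>
    add_lt_add_right (mul_lt_mul_of_pos_left (sub_lt_sub_right (hm hab) _) ht) x
  have hle : ∀ v, hopfValue f φ M (y v, t) - hopfValue f φ M (x, t) ≤ v * (y v - x) := by
    intro v
    have h1 := hopfValue_le hf hm.monotone hφ hb (p := (y v, t)) ht.le v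
    rw [hopfValue_eq_of_mem_maxSet hf hconv hm.monotone hφ hb ht.le hw]
    have h2 : y v - t * deriv f v = x - t * deriv f w := by simp only [hy]; ring
    have h3 := mul_le_mul_of_nonneg_left (tangent_le hf hm.monotone w v) ht.le
    simp only [hopfCost, h2] at h1 ⊢
    simp only [hy]
    linarith
  have htend : Tendsto y (nhdsWithin w {w}ᶜ) (nhdsWithin x {x}ᶜ) := by
    refine tendsto_nhdsWithin_iff.2
      ⟨(hyw ▸ hycont.tendsto w).mono_left nhdsWithin_le_nhds, ?_⟩
    filter_upwards [self_mem_nhdsWithin] with v hv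
    exact fun h => hv (hymono.injective (h.trans hyw.symm))
  have hslope := hd.tendsto_slope.comp htend
  have hid : Tendsto (fun v : ℝ => v) (nhds w) (nhds w) := tendsto_id
  apply le_antisymm
  · refine le_of_tendsto_of_tendsto
      (hid.mono_left nhdsWithin_le_nhds : Tendsto _ (nhdsWithin w (Iio w)) _)
      (hslope.mono_left (nhdsWithin_mono w fun v hv => (mem_Iio.1 hv).ne)) ?_
    filter_upwards [self_mem_nhdsWithin] with v hv
    have hlt : y v < x := hyw ▸ hymono hv
    simp only [Function.comp, slope_def_field]
    rw [le_div_iff_of_neg (by linarith)]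
    exact hle v
  · refine le_of_tendsto_of_tendsto
      (hslope.mono_left (nhdsWithin_mono w fun v hv => (mem_Ioi.1 hv).ne'))
      (hid.mono_left nhdsWithin_le_nhds : Tendsto _ (nhdsWithin w (Ioi w)) _) ?_
    filter_upwards [self_mem_nhdsWithin] with v hv
    have hlt : x < y v := hyw ▸ hymono hv
    simp only [Function.comp, slope_def_field]
    rw [div_le_iff₀ (by linarith)]
    exact hle v

theorem maxSet_eq_singleton {f φ : ℝ → ℝ} {M : ℝ} (hf : ContDiff ℝ 2 f)
    (hconv : ∀ u : ℝ, 0 ≤ deriv (deriv f) u) (hm : StrictMono (deriv f)) (hφ : Measurable φ)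
    (hb : ∀ x, |φ x| ≤ M) {x t d : ℝ} (ht : 0 < t)
    (hd : HasDerivAt (fun y => hopfValue f φ M (y, t)) d x) : maxSet f φ x t = {d} :=
  eq_singleton_iff_nonempty_unique_mem.2 ⟨maxSet_nonempty hf hconv hm.monotone hφ hb x ht.le,
    fun _ hw => eq_of_hasDerivAt_hopfValue hf hconv hm hφ hb ht hw hd⟩

theorem uPlus_eq_of_hasDerivAt {f φ : ℝ → ℝ} {M : ℝ} (hf : ContDiff ℝ 2 f)
    (hconv : ∀ u : ℝ, 0 ≤ deriv (deriv f) u) (hm : StrictMono (deriv f)) (hφ : Measurable φ)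
    (hb : ∀ x, |φ x| ≤ M) {x t d : ℝ} (ht : 0 < t)
    (hd : HasDerivAt (fun y => hopfValue f φ M (y, t)) d x) : uPlus f φ x t = d := by
  rw [uPlus, maxSet_eq_singleton hf hconv hm hφ hb ht hd, csInf_singleton]

/-- At differentiability points the value function solves `V_x = u` and `V_t = -f u`. -/
theorem uPlus_eq_fderiv {f φ : ℝ → ℝ} {M : ℝ} (hf : ContDiff ℝ 2 f)
    (hconv : ∀ u : ℝ, 0 ≤ deriv (deriv f) u) (hm : StrictMono (deriv f)) (hφ : Measurable φ)
    (hb : ∀ x, |φ x| ≤ M) {p : ℝ × ℝ} (hp : 0 < p.2)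
    (hd : DifferentiableAt ℝ (hopfValue f φ M) p) :
    uPlus f φ p.1 p.2 = fderiv ℝ (hopfValue f φ M) p (1, 0) ∧
      f (uPlus f φ p.1 p.2) = -fderiv ℝ (hopfValue f φ M) p (0, 1) := by
  obtain ⟨x, t⟩ := p
  set L := fderiv ℝ (hopfValue f φ M) (x, t) with hL
  have hdx : HasDerivAt (fun y => hopfValue f φ M (y, t)) (L (1, 0)) x :=
    HasFDerivAt.comp_hasDerivAt (l := hopfValue f φ M) (f := fun y => (y, t)) x hd.hasFDerivAt
      ((hasDerivAt_id x).prodMk (hasDerivAt_const x t))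
  have hu := uPlus_eq_of_hasDerivAt hf hconv hm hφ hb hp hdx
  refine ⟨hu, ?_⟩
  have hw : uPlus f φ x t ∈ maxSet f φ x t := by
    rw [hu, maxSet_eq_singleton hf hconv hm hφ hb hp hdx]
    exact mem_singleton _
  set w := uPlus f φ x t with hwdef
  have hline : HasDerivAt
      (fun s : ℝ => hopfValue f φ M (x + s * deriv f w, t + s) - s * (w * deriv f w - f w))
      (L (deriv f w, 1) - (w * deriv f w - f w)) 0 := by
    refine HasDerivAt.sub ?_ (hasDerivAt_mul_const _)
    refine HasFDerivAt.comp_hasDerivAt (l := hopfValue f φ M) (0 : ℝ) ?_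
      (((hasDerivAt_mul_const (deriv f w)).const_add x).prodMk
        ((hasDerivAt_id (0 : ℝ)).const_add t))
    simpa using hd.hasFDerivAt
  have hmax : IsLocalMax (fun s : ℝ =>
      hopfValue f φ M (x + s * deriv f w, t + s) - s * (w * deriv f w - f w)) 0 := by
    filter_upwards [Ioi_mem_nhds (neg_lt_zero.2 hp)] with s hs
    have hs' : 0 ≤ t + s := by linarith [mem_Ioi.1 hs]
    have h1 := hopfValue_le hf hm.monotone hφ hb (p := (x + s * deriv f w, t + s)) hs' w
    have h2 : x + s * deriv f w - (t + s) * deriv f w = x - t * deriv f w := by ring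
    simp only [zero_mul, add_zero, sub_zero]
    rw [hopfValue_eq_of_mem_maxSet hf hconv hm.monotone hφ hb hp.le hw]
    simp only [hopfCost, h2] at h1 ⊢
    linarith
  have h0 := hmax.hasDerivAt_eq_zero hline
  have hsplit : L (deriv f w, 1) = deriv f w * L (1, 0) + L (0, 1) := by
    rw [← smul_eq_mul, ← map_smul, ← map_add]
    simp
  rw [hsplit, ← hu] at h0
  linarith

theorem integral_uPlus {f φ : ℝ → ℝ} {M : ℝ} (hf : ContDiff ℝ 2 f)
    (hconv : ∀ u : ℝ, 0 ≤ deriv (deriv f) u) (hm : StrictMono (deriv f)) (hφ : Measurable φ)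
    (hb : ∀ x, |φ x| ≤ M) (x₁ x₂ : ℝ) {t : ℝ} (ht : 0 < t) :
    ∫ x in x₁..x₂, uPlus f φ x t = hopfValue f φ M (x₂, t) - hopfValue f φ M (x₁, t) := by
  obtain ⟨C, hC⟩ := exists_lipschitzWith_hopfValue hf hφ hb
  have hlip : LipschitzWith (C * 1) fun x => hopfValue f φ M (x, t) :=
    hC.comp (LipschitzWith.prodMk_right t)
  have hac := (hlip.lipschitzOnWith (s := uIcc x₁ x₂)).absolutelyContinuousOnInterval
  rw [← hac.integral_deriv_eq_sub]
  refine intervalIntegral.integral_congr_ae ?_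
  filter_upwards [hlip.ae_differentiableAt (μ := volume)] with x hx _
  exact uPlus_eq_of_hasDerivAt hf hconv hm hφ hb ht hx.hasDerivAt

/-- The weak form of `∂ₓ∂ₜ V = ∂ₜ∂ₓ V` for Lipschitz `V`. -/
theorem integral_lineDeriv_mul_fderiv_comm {V ϕ : ℝ × ℝ → ℝ} {C : NNReal}
    (hV : LipschitzWith C V) (hϕ : ContDiff ℝ 3 ϕ) (hc : HasCompactSupport ϕ) (a b : ℝ × ℝ) :
    ∫ p, lineDeriv ℝ V p a * fderiv ℝ ϕ p b = ∫ p, lineDeriv ℝ V p b * fderiv ℝ ϕ p a := by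
  have hs : ∀ v, ContDiff ℝ 2 fun p => fderiv ℝ ϕ p v := fun v =>
    (hϕ.fderiv_right (by norm_num)).clm_apply contDiff_const
  have hcs : ∀ v, HasCompactSupport fun p => fderiv ℝ ϕ p v := fun v => hc.fderiv_apply ℝ v
  have hl : ∀ v, ∃ D, LipschitzWith D fun p => fderiv ℝ ϕ p v := fun v =>
    (hs v).lipschitzWith_of_hasCompactSupport (hcs v) two_ne_zero
  obtain ⟨_, ha⟩ := hl a
  obtain ⟨_, hb⟩ := hl b
  rw [hV.integral_lineDeriv_mul_eq hb (hcs b), hV.integral_lineDeriv_mul_eq ha (hcs a)]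
  refine integral_congr_ae (Eventually.of_forall fun p => ?_)
  have hd : ∀ v w, lineDeriv ℝ (fun q => fderiv ℝ ϕ q v) p w
      = fderiv ℝ (fderiv ℝ ϕ) p w v := fun v w => by
    have hd2 : DifferentiableAt ℝ (fderiv ℝ ϕ) p :=
      (hϕ.fderiv_right (m := 2) (by norm_num)).differentiable two_ne_zero p
    rw [((hs v).differentiable two_ne_zero p).lineDeriv_eq_fderiv,
      fderiv_clm_apply hd2 (differentiableAt_const v)]
    simp
  have hsymm : IsSymmSndFDerivAt ℝ ϕ p :=
    hϕ.contDiffAt.isSymmSndFDerivAt (by simp; norm_num)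
  simp only [hd, map_neg, neg_apply]
  rw [hsymm.eq a b]

theorem integrable_lineDeriv_mul_fderiv {V ϕ : ℝ × ℝ → ℝ} {C : NNReal}
    (hV : LipschitzWith C V) (hϕ : ContDiff ℝ 3 ϕ) (hc : HasCompactSupport ϕ) (a b : ℝ × ℝ) :
    Integrable fun p => lineDeriv ℝ V p a * fderiv ℝ ϕ p b := by
  have hcont : Continuous fun p => fderiv ℝ ϕ p b :=
    (hϕ.continuous_fderiv (by norm_num)).clm_apply continuous_const
  refine (hcont.integrable_of_hasCompactSupport (hc.fderiv_apply ℝ b)).bdd_mul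
    (c := C * ‖a‖) (measurable_lineDeriv hV.continuous).aestronglyMeasurable
    (Eventually.of_forall fun p => norm_lineDeriv_le_of_lipschitz ℝ hV)

/-- `u := u⁺` given by the new formula is a weak solution of the Cauchy
problem `u_t + f(u)_x = 0`, `u|_{t=0} = φ`. -/
theorem stmt0_new_formula_weak_solution
    (f φ : ℝ → ℝ) (M : ℝ)
    (hf : ContDiff ℝ 2 f)
    (hconv : ∀ u : ℝ, 0 ≤ deriv (deriv f) u)
    (hdeg : volume {u : ℝ | deriv (deriv f) u = 0} = 0)
    (hφmeas : Measurable φ)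
    (hφbdd : ∀ x : ℝ, |φ x| ≤ M) :
    (∀ ϕ : ℝ × ℝ → ℝ, (∀ n : ℕ, ContDiff ℝ n ϕ) → HasCompactSupport ϕ →
      tsupport ϕ ⊆ (Set.univ : Set ℝ) ×ˢ Set.Ioi (0:ℝ) →
      (∫ x : ℝ, ∫ t in Set.Ioi (0:ℝ),
        (uPlus f φ x t * deriv (fun τ : ℝ => ϕ (x, τ)) t
          + f (uPlus f φ x t) * deriv (fun y : ℝ => ϕ (y, t)) x)) = 0) ∧
    (∀ x₁ x₂ : ℝ,
      Tendsto (fun t : ℝ => ∫ x in x₁..x₂, uPlus f φ x t)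
        (nhdsWithin 0 (Set.Ioi 0)) (nhds (∫ x in x₁..x₂, φ x))) := by
  have hm := strictMono_deriv_of_null hf hconv hdeg
  obtain ⟨C, hC⟩ := exists_lipschitzWith_hopfValue hf hφmeas hφbdd
  refine ⟨fun ϕ hϕ hcs hsupp => ?_, fun x₁ x₂ => ?_⟩
  · have hϕ3 : ContDiff ℝ 3 ϕ := hϕ 3
    have hdiff : Differentiable ℝ ϕ := hϕ3.differentiable (by norm_num)
    have hdt : ∀ x t : ℝ, deriv (fun τ : ℝ => ϕ (x, τ)) t = fderiv ℝ ϕ (x, t) (0, 1) :=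
      fun x t => ((hdiff (x, t)).hasFDerivAt.comp_hasDerivAt t
        ((hasDerivAt_const t x).prodMk (hasDerivAt_id t))).deriv
    have hdx : ∀ x t : ℝ, deriv (fun y : ℝ => ϕ (y, t)) x = fderiv ℝ ϕ (x, t) (1, 0) :=
      fun x t => ((hdiff (x, t)).hasFDerivAt.comp_hasDerivAt x
        ((hasDerivAt_id x).prodMk (hasDerivAt_const x t))).deriv
    have hzero : ∀ p : ℝ × ℝ, p.2 ≤ 0 → fderiv ℝ ϕ p = 0 := fun p hp => by
      by_contra h
      exact not_lt.2 hp (hsupp (support_fderiv_subset ℝ h)).2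
    set F : ℝ × ℝ → ℝ := fun p => uPlus f φ p.1 p.2 * fderiv ℝ ϕ p (0, 1)
      + f (uPlus f φ p.1 p.2) * fderiv ℝ ϕ p (1, 0) with hF
    set V := hopfValue f φ M with hV
    have hFG : F =ᵐ[volume] fun p => lineDeriv ℝ V p (1, 0) * fderiv ℝ ϕ p (0, 1)
        - lineDeriv ℝ V p (0, 1) * fderiv ℝ ϕ p (1, 0) := by
      filter_upwards [hC.ae_differentiableAt (μ := volume)] with p hp
      rcases le_or_gt p.2 0 with h | h
      · simp [hF, hzero p h]
      · obtain ⟨h1, h2⟩ := uPlus_eq_fderiv hf hconv hm hφmeas hφbdd h hp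
        simp only [hF]
        rw [hp.lineDeriv_eq_fderiv, hp.lineDeriv_eq_fderiv, h2, h1]
        ring
    have hi := fun a b => integrable_lineDeriv_mul_fderiv hC hϕ3 hcs a b
    have hFint : Integrable F := ((hi _ _).sub (hi _ _)).congr hFG.symm
    have hFzero : ∫ p, F p = 0 := by
      rw [integral_congr_ae hFG, integral_sub (hi _ _) (hi _ _),
        integral_lineDeriv_mul_fderiv_comm hC hϕ3 hcs, sub_self]
    have hprod : ∫ p, F p = ∫ x, ∫ t, F (x, t) := integral_prod F hFint
    refine Eq.trans ?_ (hprod.symm.trans hFzero)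
    refine integral_congr_ae (Eventually.of_forall fun x => ?_)
    simp only [hdt, hdx]
    exact setIntegral_eq_integral_of_forall_compl_eq_zero fun t ht => by
      simp [hzero (x, t) (not_lt.1 ht)]
  · have hcont : Continuous fun t =>
        hopfValue f φ M (x₂, t) - hopfValue f φ M (x₁, t) := by
      have := hC.continuous
      fun_prop
    have hlim := (hcont.tendsto 0).mono_left (nhdsWithin_le_nhds (s := Ioi 0))
    rw [hopfValue_zero hf hφmeas hφbdd, hopfValue_zero hf hφmeas hφbdd,
      potential_sub hφmeas hφbdd] at hlim
    refine hlim.congr' ?_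
    filter_upwards [self_mem_nhdsWithin] with t ht
    exact (integral_uPlus hf hconv hm hφmeas hφbdd x₁ x₂ ht).symm
end

section
/- (Uniqueness of entropy solutions.) Let u₁, u₂ : ℝ × (0,∞) → ℝ be bounded measurable functions that both satisfy: (a) ∫∫_{ℝ×(0,∞)} ( uᵢ(x,t)·∂ₜϕ(x,t) + f(uᵢ(x,t))·∂ₓϕ(x,t) ) dx dt = 0 for every infinitely differentiable ϕ : ℝ × ℝ → ℝ with compact support contained in ℝ × (0,∞); (b) lim_{t→0⁺} ∫_{x₁}^{x₂} uᵢ(x,t) dx = ∫_{x₁}^{x₂} φ(x) dx for all x₁, x₂ ∈ ℝ; and (c) the Oleinik one-sided inequality f'(uᵢ(x₂,t)) − f'(uᵢ(x₁,t)) ≤ (x₂ − x₁)/t for all x₁ < x₂ and all t > 0. Then u₁ = u₂ almost everywhere on ℝ × (0,∞). -/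
open MeasureTheory Filter Set

section

open scoped ContDiff Topology Convolution

/-- Smooth functions on the line with compact support contained in `S`. -/
structure IsTestOn (S : Set ℝ) (θ : ℝ → ℝ) : Prop where
  smooth : ContDiff ℝ ∞ θ
  compact : HasCompactSupport θ
  subset : tsupport θ ⊆ S

namespace IsTestOn

variable {S : Set ℝ} {θ ψ : ℝ → ℝ}

theorem continuous (h : IsTestOn S θ) : Continuous θ := h.smooth.continuous

theorem integrable (h : IsTestOn S θ) : Integrable θ :=
  h.continuous.integrable_of_hasCompactSupport h.compact

theorem deriv (h : IsTestOn S θ) : IsTestOn S (deriv θ) :=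
  ⟨(contDiff_infty_iff_deriv.1 h.smooth).2, h.compact.deriv,
    (tsupport_deriv_subset).trans h.subset⟩

theorem sub (hθ : IsTestOn S θ) (hψ : IsTestOn S ψ) : IsTestOn S (fun x => θ x - ψ x) :=
  ⟨hθ.smooth.sub hψ.smooth, hθ.compact.sub hψ.compact,
    (tsupport_sub θ ψ).trans (union_subset hθ.subset hψ.subset)⟩

theorem const_mul (c : ℝ) (h : IsTestOn S θ) : IsTestOn S (fun x => c * θ x) :=
  ⟨contDiff_const.mul h.smooth, h.compact.mul_left,
    (tsupport_mul_subset_right (f := fun _ => c)).trans h.subset⟩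

theorem integrable_mul (h : IsTestOn S θ) {F : ℝ → ℝ} (hF : LocallyIntegrable F) :
    Integrable (fun x => θ x * F x) := by
  simpa using hF.integrable_smul_left_of_hasCompactSupport h.continuous h.compact

theorem eq_zero_of_notMem (h : IsTestOn S θ) {x : ℝ} (hx : x ∉ S) : θ x = 0 :=
  image_eq_zero_of_notMem_tsupport fun hx' => hx (h.subset hx')

/-- A test function with zero mean is the derivative of a test function. -/
theorem exists_deriv_eq (hS : S.OrdConnected) (h : IsTestOn S θ) (h0 : ∫ x, θ x = 0) :
    ∃ χ, IsTestOn S χ ∧ _root_.deriv χ = θ := by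
  rcases (tsupport θ).eq_empty_or_nonempty with he | hne
  · refine ⟨θ, h, ?_⟩
    have : θ = 0 := tsupport_eq_empty_iff.1 he
    subst this
    ext x
    simp
  · obtain ⟨a, ha, hmin⟩ := h.compact.isCompact.exists_isLeast hne
    obtain ⟨b, hb, hmax⟩ := h.compact.isCompact.exists_isGreatest hne
    have hI : Icc a b ⊆ S := hS.out (h.subset ha) (h.subset hb)
    have hd : ∀ x, HasDerivAt (fun x => ∫ y in a..x, θ y) (θ x) x := fun x =>
      intervalIntegral.integral_hasDerivAt_right (h.continuous.intervalIntegrable _ _)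
        (h.continuous.stronglyMeasurableAtFilter _ _) h.continuous.continuousAt
    have hderiv : _root_.deriv (fun x => ∫ y in a..x, θ y) = θ := funext fun x => (hd x).deriv
    have hout : ∀ x, x < a ∨ b < x → θ x = 0 := fun x hx =>
      image_eq_zero_of_notMem_tsupport fun hx' => by
        rcases hx with hx | hx
        · exact absurd (hmin hx') (not_le.2 hx)
        · exact absurd (hmax hx') (not_le.2 hx)
    have hsupp : Function.support (fun x => ∫ y in a..x, θ y) ⊆ Icc a b := by
      intro x hx
      by_contra hx'
      apply hx
      change ∫ y in a..x, θ y = 0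
      rcases lt_or_ge x a with hxa | hxa
      · rw [intervalIntegral.integral_of_ge hxa.le, ← integral_Ico_eq_integral_Ioc,
          setIntegral_eq_zero_of_forall_eq_zero fun y hy => hout y (Or.inl hy.2), neg_zero]
      · have hxb : b < x := by
          by_contra hc
          exact hx' ⟨hxa, not_lt.1 hc⟩
        rw [intervalIntegral.integral_of_le hxa, ← integral_Icc_eq_integral_Ioc,
          setIntegral_eq_integral_of_forall_compl_eq_zero, h0]
        intro y hy
        apply hout
        by_contra hc
        push Not at hc
        exact hy ⟨hc.1, hc.2.trans hxb.le⟩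
    have htsupp := closure_minimal hsupp isClosed_Icc
    refine ⟨fun x => ∫ y in a..x, θ y, ⟨?_, ?_, htsupp.trans hI⟩, hderiv⟩
    · rw [contDiff_infty_iff_deriv, hderiv]
      exact ⟨fun x => (hd x).differentiableAt, h.smooth⟩
    · exact HasCompactSupport.of_support_subset_isCompact isCompact_Icc hsupp

theorem exists_deriv_eq_sub (hS : S.OrdConnected) (hψ : IsTestOn S ψ) (hθ : IsTestOn S θ)
    (hθ1 : ∫ x, θ x = 1) :
    ∃ χ, IsTestOn S χ ∧ _root_.deriv χ = fun x => ψ x - (∫ y, ψ y) * θ x := by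
  refine exists_deriv_eq hS (hψ.sub (hθ.const_mul _)) ?_
  rw [integral_sub hψ.integrable (hθ.integrable.const_mul _), integral_const_mul, hθ1]
  ring

theorem normed_sub (f : ContDiffBump (0 : ℝ)) (c : ℝ) :
    IsTestOn univ (fun x => f.normed volume (c - x)) := by
  refine ⟨f.contDiff_normed.comp (contDiff_const.sub contDiff_id), ?_, subset_univ _⟩
  exact f.hasCompactSupport_normed.comp_homeomorph (Homeomorph.subLeft c)

/-- Integration by parts against a primitive of a locally integrable function. -/
theorem integral_mul_eq_neg (h : IsTestOn S θ) {n : ℝ → ℝ} (hn : LocallyIntegrable n) (a : ℝ) :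
    ∫ x, θ x * n x = -∫ x, _root_.deriv θ x * ∫ y in a..x, n y := by
  obtain ⟨R, hR⟩ := (h.compact.isCompact.union isCompact_singleton).isBounded.subset_ball_lt 0 0
    (s := tsupport θ ∪ {a})
  obtain ⟨hR0, hR⟩ := hR
  rw [Real.ball_eq_Ioo, zero_sub, zero_add] at hR
  have ha : a ∈ Ioo (-R) R := hR (Or.inr rfl)
  have hout : ∀ (χ : ℝ → ℝ), tsupport χ ⊆ tsupport θ → ∀ F : ℝ → ℝ,
      ∫ x, χ x * F x = ∫ x in (-R)..R, χ x * F x := by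
    intro χ hχ F
    rw [intervalIntegral.integral_of_le (by linarith),
      setIntegral_eq_integral_of_forall_compl_eq_zero]
    intro x hx
    have : χ x = 0 := image_eq_zero_of_notMem_tsupport fun hx' =>
      hx (Ioo_subset_Ioc_self (hR (Or.inl (hχ hx'))))
    rw [this, zero_mul]
  have hint : ∀ x y, IntervalIntegrable n volume x y := fun x y =>
    intervalIntegrable_iff.2 ((hn.integrableOn_isCompact isCompact_uIcc).mono_set uIoc_subset_uIcc)
  have hN : AbsolutelyContinuousOnInterval (fun x => ∫ y in a..x, n y) (-R) R :=
    (hint _ _).absolutelyContinuousOnInterval_intervalIntegral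
      (by rw [uIcc_of_le (by linarith)]; exact Ioo_subset_Icc_self ha)
  have hθ : AbsolutelyContinuousOnInterval θ (-R) R :=
    ((h.smooth.of_le (by exact_mod_cast le_top)).contDiffOn).absolutelyContinuousOnInterval
  have hz : ∀ x, x ∉ Ioo (-R) R → θ x = 0 := fun x hx =>
    image_eq_zero_of_notMem_tsupport fun hx' => hx (hR (Or.inl hx'))
  have key := hθ.integral_mul_deriv_eq_deriv_mul hN
  rw [hz R (by simp), hz (-R) (by simp)] at key
  rw [hout θ subset_rfl, hout _ (tsupport_deriv_subset)]
  rw [zero_mul, zero_mul, sub_zero, zero_sub] at key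
  rw [← key]
  apply intervalIntegral.integral_congr_ae
  filter_upwards [_root_.LocallyIntegrable.ae_hasDerivAt_integral hn] with x hx _
  rw [(hx a).deriv]

end IsTestOn

theorem Measurable.locallyIntegrable_of_abs_le {n : ℝ → ℝ} {C : ℝ} (hn : Measurable n)
    (hC : ∀ x, |n x| ≤ C) : LocallyIntegrable n :=
  (locallyIntegrable_const C).mono hn.aestronglyMeasurable
    (Eventually.of_forall fun x => (hC x).trans (le_abs_self C))

theorem MeasureTheory.LocallyIntegrable.intervalIntegrable' {n : ℝ → ℝ} (hn : LocallyIntegrable n)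
    (a b : ℝ) : IntervalIntegrable n volume a b :=
  intervalIntegrable_iff.2 ((hn.integrableOn_isCompact isCompact_uIcc).mono_set uIoc_subset_uIcc)

/-- A bounded weak solution of `dm/dt = n` on `(0, ∞)` with zero initial trace. -/
theorem ae_eq_integral_of_weak_deriv {m n : ℝ → ℝ} (hm : LocallyIntegrable m)
    (hn : LocallyIntegrable n)
    (hweak : ∀ η, IsTestOn (Ioi 0) η → ∫ t in Ioi (0 : ℝ), (m t * deriv η t + n t * η t) = 0)
    (h0 : Tendsto m (𝓝[>] 0) (𝓝 0)) :
    ∀ᵐ t, 0 < t → m t = ∫ s in (0 : ℝ)..t, n s := by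
  set h : ℝ → ℝ := fun t => m t - ∫ s in (0 : ℝ)..t, n s with hh
  have hNcont : Continuous fun t => ∫ s in (0 : ℝ)..t, n s :=
    intervalIntegral.continuous_primitive hn.intervalIntegrable' 0
  have hhloc : LocallyIntegrable h := hm.sub hNcont.locallyIntegrable
  have hderiv : ∀ η, IsTestOn (Ioi 0) η → ∫ t, deriv η t * h t = 0 := by
    intro η hη
    have h1 := hweak η hη
    rw [setIntegral_eq_integral_of_forall_compl_eq_zero] at h1
    · rw [integral_add (by simpa [mul_comm] using hη.deriv.integrable_mul hm)
        (by simpa [mul_comm] using hη.integrable_mul hn)] at h1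
      have h2 := hη.integral_mul_eq_neg hn 0
      simp only [hh, mul_sub]
      rw [integral_sub (hη.deriv.integrable_mul hm)
        (hη.deriv.integrable_mul hNcont.locallyIntegrable)]
      simp only [mul_comm (m _), mul_comm (n _)] at h1
      linarith
    · intro t ht
      rw [hη.eq_zero_of_notMem ht, hη.deriv.eq_zero_of_notMem ht]
      ring
  let ρ : ContDiffBump (2 : ℝ) := ⟨1 / 2, 1, by norm_num, by norm_num⟩
  have hρ : IsTestOn (Ioi 0) (ρ.normed volume) := by
    refine ⟨ρ.contDiff_normed, ρ.hasCompactSupport_normed, ?_⟩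
    rw [ρ.tsupport_normed_eq, Real.closedBall_eq_Icc]
    intro x hx
    have : (2 : ℝ) - 1 ≤ x := hx.1
    change 0 < x
    linarith
  set c := ∫ t, ρ.normed volume t * h t with hc
  have hconst : ∀ᵐ t, t ∈ Ioi (0 : ℝ) → h t - c = 0 := by
    refine isOpen_Ioi.ae_eq_zero_of_integral_contDiff_smul_eq_zero
      ((hhloc.sub (locallyIntegrable_const c)).locallyIntegrableOn _) ?_
    intro ψ hψ1 hψ2 hψ3
    have hψ : IsTestOn (Ioi 0) ψ := ⟨hψ1, hψ2, hψ3⟩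
    obtain ⟨χ, hχ, hχd⟩ := IsTestOn.exists_deriv_eq_sub ordConnected_Ioi hψ hρ ρ.integral_normed
    have h1 := hderiv χ hχ
    simp only [hχd, sub_mul, mul_assoc] at h1
    rw [integral_sub (hψ.integrable_mul hhloc) ((hρ.integrable_mul hhloc).const_mul _),
      integral_const_mul] at h1
    simp only [smul_eq_mul, mul_sub]
    rw [integral_sub (hψ.integrable_mul hhloc) (hψ.integrable.mul_const c), integral_mul_const]
    exact h1
  have hlim : Tendsto h (𝓝[>] 0) (𝓝 0) := by
    have : Tendsto (fun t => ∫ s in (0 : ℝ)..t, n s) (𝓝[>] 0) (𝓝 0) := by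
      simpa using (hNcont.tendsto 0).mono_left nhdsWithin_le_nhds
    simpa [hh] using h0.sub this
  have hc0 : c = 0 := by
    by_contra hne
    have h1 : ∀ᶠ t in 𝓝[>] 0, h t ≠ c := hlim.eventually_ne (Ne.symm hne)
    obtain ⟨δ, hδ, hsub⟩ := mem_nhdsGT_iff_exists_Ioo_subset.1 h1
    have h2 : ∀ᵐ t, t ∉ Ioo (0 : ℝ) δ := by
      filter_upwards [hconst] with t ht htI
      exact hsub htI (sub_eq_zero.1 (ht htI.1))
    have h3 : volume (Ioo (0 : ℝ) δ) = 0 := by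
      rw [ae_iff] at h2
      simpa only [not_not, ofPred_mem_eq] using h2
    rw [Real.volume_Ioo, sub_zero, ENNReal.ofReal_eq_zero] at h3
    exact absurd h3 (not_le.2 hδ)
  filter_upwards [hconst] with t ht ht0
  have := ht ht0
  rw [hc0, sub_zero] at this
  exact sub_eq_zero.1 this

/-- If `∂ₓ F(·, t) = 0` weakly for almost every `t > 0`, tested one function at a time, then
`F(·, t)` is almost everywhere constant for almost every `t > 0`. -/
theorem ae_const_of_weak_deriv_eq_zero {F : ℝ → ℝ → ℝ}
    (hF : ∀ t, LocallyIntegrable (fun x => F x t))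
    (h : ∀ χ, IsTestOn univ χ → ∀ᵐ t, 0 < t → ∫ x, deriv χ x * F x t = 0) :
    ∀ᵐ t, 0 < t → ∃ c, ∀ᵐ x, F x t = c := by
  let ρ : ContDiffBump (0 : ℝ) := ⟨1 / 2, 1, by norm_num, by norm_num⟩
  have hρ : IsTestOn univ (ρ.normed volume) :=
    ⟨ρ.contDiff_normed, ρ.hasCompactSupport_normed, subset_univ _⟩
  have hψ : ∀ ψ, IsTestOn univ ψ → ∀ᵐ t, 0 < t →
      ∫ x, ψ x * (F x t - ∫ y, ρ.normed volume y * F y t) = 0 := by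
    intro ψ hψ
    obtain ⟨χ, hχ, hχd⟩ := IsTestOn.exists_deriv_eq_sub ordConnected_univ hψ hρ ρ.integral_normed
    filter_upwards [h χ hχ] with t ht ht0
    have h1 := ht ht0
    simp only [hχd, sub_mul, mul_assoc] at h1
    rw [integral_sub (hψ.integrable_mul (hF t)) ((hρ.integrable_mul (hF t)).const_mul _),
      integral_const_mul] at h1
    simp only [mul_sub]
    rw [integral_sub (hψ.integrable_mul (hF t)) (hψ.integrable.mul_const _), integral_mul_const]
    exact h1
  let β : ℕ → ContDiffBump (0 : ℝ) := fun n =>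
    ⟨1 / (2 * ((n : ℝ) + 1)), 1 / ((n : ℝ) + 1), by positivity, by
      gcongr
      linarith [show (0 : ℝ) ≤ n from n.cast_nonneg]⟩
  have hall : ∀ᵐ t, ∀ n : ℕ, ∀ q : ℚ, 0 < t →
      ∫ x, (β n).normed volume ((q : ℝ) - x) * (F x t - ∫ y, ρ.normed volume y * F y t) = 0 :=
    ae_all_iff.2 fun n => ae_all_iff.2 fun q => hψ _ (IsTestOn.normed_sub (β n) q)
  filter_upwards [hall] with t ht ht0
  set c := ∫ y, ρ.normed volume y * F y t
  refine ⟨c, ?_⟩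
  have hG : LocallyIntegrable (fun x => F x t - c) := (hF t).sub (locallyIntegrable_const c)
  have hconv : ∀ n x, ((β n).normed volume ⋆[ContinuousLinearMap.lsmul ℝ ℝ, volume]
      fun x => F x t - c) x = 0 := by
    intro n
    have hcont : Continuous ((β n).normed volume ⋆[ContinuousLinearMap.lsmul ℝ ℝ, volume]
        fun x => F x t - c) :=
      (β n).hasCompactSupport_normed.continuous_convolution_left _ (β n).continuous_normed hG
    have hext := Continuous.ext_on Rat.denseRange_cast hcont continuous_const (g := fun _ => 0) (by
      rintro _ ⟨q, rfl⟩
      rw [convolution_eq_swap]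
      simpa using ht n q ht0)
    exact fun x => congrFun hext x
  have hβ : Tendsto (fun n => (β n).rOut) atTop (𝓝 0) := tendsto_one_div_add_atTop_nhds_zero_nat
  filter_upwards [ContDiffBump.ae_convolution_tendsto_right_of_locallyIntegrable (K := 2) hβ
    (Eventually.of_forall fun n => by
      change 1 / ((n : ℝ) + 1) ≤ 2 * (1 / (2 * ((n : ℝ) + 1)))
      apply le_of_eq
      field_simp) hG] with x hx
  simp only [hconv] at hx
  exact sub_eq_zero.1 (tendsto_nhds_unique hx tendsto_const_nhds)

theorem measurable_intervalIntegral_right {g : ℝ → ℝ → ℝ}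
    (hg : Measurable fun p : ℝ × ℝ => g p.1 p.2) :
    Measurable fun p : ℝ × ℝ => ∫ s in (0 : ℝ)..p.2, g p.1 s := by
  have key : ∀ a b : ℝ × ℝ → ℝ, Measurable a → Measurable b →
      Measurable fun p : ℝ × ℝ => ∫ s in Ioc (a p) (b p), g p.1 s := by
    intro a b ha hb
    simp only [← integral_indicator measurableSet_Ioc]
    have hset : MeasurableSet {q : (ℝ × ℝ) × ℝ | a q.1 < q.2 ∧ q.2 ≤ b q.1} :=
      (measurableSet_lt (ha.comp measurable_fst) measurable_snd).inter
        (measurableSet_le measurable_snd (hb.comp measurable_fst))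
    have hm : Measurable ({q : (ℝ × ℝ) × ℝ | a q.1 < q.2 ∧ q.2 ≤ b q.1}.indicator
        fun q => g q.1.1 q.2) :=
      (hg.comp ((measurable_fst.comp measurable_fst).prodMk measurable_snd)).indicator hset
    exact (hm.stronglyMeasurable.integral_prod_right' (ν := volume)).measurable
  exact (key _ _ measurable_const measurable_snd).sub (key _ _ measurable_snd measurable_const)

theorem abs_intervalIntegral_le {g : ℝ → ℝ} {C : ℝ} (hC : ∀ s, |g s| ≤ C) (a b : ℝ) :
    |∫ s in a..b, g s| ≤ C * |b - a| := by
  have := intervalIntegral.norm_integral_le_of_norm_le_const (f := g) (a := a) (b := b)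
    fun s _ => (Real.norm_eq_abs (g s)).trans_le (hC s)
  rwa [Real.norm_eq_abs] at this

/-- A measurable function on the plane times a product of integrable functions. -/
theorem integrable_mul_mul_of_abs_le {w : ℝ → ℝ → ℝ} {C : ℝ} {μ : Measure ℝ} [SFinite μ]
    (hw : Measurable fun p : ℝ × ℝ => w p.1 p.2) (hwC : ∀ x t, |w x t| ≤ C) {a b : ℝ → ℝ}
    (ha : Integrable a) (hb : Integrable b μ) :
    Integrable (fun p : ℝ × ℝ => w p.1 p.2 * (a p.1 * b p.2)) (volume.prod μ) :=
  (ha.mul_prod hb).bdd_mul hw.aestronglyMeasurable (Eventually.of_forall fun p => hwC p.1 p.2)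

/-- The flux primitive `∫₀ᵗ g(x, s) ds` of a bounded weak solution of `vₜ + gₓ = 0` with zero
initial trace is, for almost every `t > 0`, a spatial primitive of `-v(·, t)`. -/
theorem ae_flux_primitive_add_eq_const {v g : ℝ → ℝ → ℝ} {C : ℝ}
    (hv : Measurable fun p : ℝ × ℝ => v p.1 p.2) (hg : Measurable fun p : ℝ × ℝ => g p.1 p.2)
    (hvC : ∀ x t, |v x t| ≤ C) (hgC : ∀ x t, |g x t| ≤ C)
    (hweak : ∀ χ η, IsTestOn univ χ → IsTestOn (Ioi 0) η →
      ∫ x, ∫ t in Ioi (0 : ℝ), (v x t * (χ x * deriv η t) + g x t * (deriv χ x * η t)) = 0)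
    (hinit : ∀ x₁ x₂ : ℝ, Tendsto (fun t => ∫ x in x₁..x₂, v x t) (𝓝[>] 0) (𝓝 0)) :
    ∀ᵐ t, 0 < t → ∃ c, ∀ᵐ x, (∫ s in (0 : ℝ)..t, g x s) + ∫ y in (0 : ℝ)..x, v y t = c := by
  have hvt : ∀ t, Measurable fun x => v x t := fun t =>
    hv.comp (measurable_id.prodMk measurable_const)
  have hgt : ∀ t, Measurable fun x => g x t := fun t =>
    hg.comp (measurable_id.prodMk measurable_const)
  have hvl : ∀ t, LocallyIntegrable fun x => v x t := fun t =>
    (hvt t).locallyIntegrable_of_abs_le fun x => hvC x t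
  have hgl : ∀ t, LocallyIntegrable fun x => g x t := fun t =>
    (hgt t).locallyIntegrable_of_abs_le fun x => hgC x t
  have hQ : ∀ t, LocallyIntegrable fun x => ∫ s in (0 : ℝ)..t, g x s := fun t =>
    ((measurable_intervalIntegral_right hg).comp
      (measurable_id.prodMk measurable_const)).locallyIntegrable_of_abs_le
      fun x => abs_intervalIntegral_le (hgC x) 0 t
  have hP : ∀ t, LocallyIntegrable fun x => ∫ y in (0 : ℝ)..x, v y t := fun t =>
    (intervalIntegral.continuous_primitive (hvl t).intervalIntegrable' 0).locallyIntegrable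
  have hC0 : 0 ≤ C := (abs_nonneg _).trans (hvC 0 0)
  have hpair : ∀ (w : ℝ → ℝ → ℝ), (Measurable fun p : ℝ × ℝ => w p.1 p.2) →
      (∀ x t, |w x t| ≤ C) → ∀ θ, IsTestOn univ θ →
      LocallyIntegrable fun t => ∫ x, θ x * w x t := by
    intro w hw hwC θ hθ
    refine Measurable.locallyIntegrable_of_abs_le (C := ∫ x, |θ x| * C) ?_ fun t => ?_
    · have : Measurable fun p : ℝ × ℝ => θ p.2 * w p.2 p.1 :=
        (hθ.continuous.measurable.comp measurable_snd).mul
          (hw.comp (measurable_snd.prodMk measurable_fst))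
      exact (this.stronglyMeasurable.integral_prod_right' (ν := volume)).measurable
    · refine (abs_integral_le_integral_abs).trans (integral_mono_of_nonneg
        (Eventually.of_forall fun x => abs_nonneg _) (hθ.integrable.abs.mul_const C)
        (Eventually.of_forall fun x => ?_))
      simp only [abs_mul]
      gcongr
      exact hwC x t
  refine ae_const_of_weak_deriv_eq_zero (fun t => (hQ t).add (hP t)) fun χ hχ => ?_
  have htime := ae_eq_integral_of_weak_deriv (hpair v hv hvC χ hχ) (hpair g hg hgC _ hχ.deriv)
    (fun η hη => by
      have h1 := integrable_mul_mul_of_abs_le (μ := volume.restrict (Ioi 0)) hv hvC hχ.integrable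
        hη.deriv.integrable.restrict
      have h2 := integrable_mul_mul_of_abs_le (μ := volume.restrict (Ioi 0)) hg hgC hχ.deriv.integrable
        hη.integrable.restrict
      have h3 : ∫ t in Ioi (0 : ℝ), ∫ x,
          (v x t * (χ x * deriv η t) + g x t * (deriv χ x * η t)) = 0 :=
        (integral_integral_swap (h1.add h2)).symm.trans (hweak χ η hχ hη)
      refine Eq.trans ?_ h3
      refine integral_congr_ae ?_
      filter_upwards [h1.prod_left_ae, h2.prod_left_ae] with t ht1 ht2
      rw [integral_add ht1 ht2, ← integral_mul_const, ← integral_mul_const]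
      congr 1 <;> exact integral_congr_ae (Eventually.of_forall fun x => by ring))
    (by
      have hrw : ∀ t, ∫ x, χ x * v x t = -∫ x, deriv χ x * ∫ y in (0 : ℝ)..x, v y t := fun t =>
        hχ.integral_mul_eq_neg (hvl t) 0
      simp only [hrw]
      rw [← neg_zero]
      refine Tendsto.neg ?_
      have : Tendsto (fun t => ∫ x, deriv χ x * ∫ y in (0 : ℝ)..x, v y t) (𝓝[>] 0)
          (𝓝 (∫ x, deriv χ x * 0)) := by
        refine tendsto_integral_filter_of_dominated_convergence
          (fun x => |deriv χ x| * (C * |x - 0|)) (Eventually.of_forall fun t =>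
            (hχ.deriv.integrable_mul (hP t)).aestronglyMeasurable)
          (Eventually.of_forall fun t => Eventually.of_forall fun x => ?_) ?_
          (Eventually.of_forall fun x => (hinit 0 x).const_mul _)
        · rw [Real.norm_eq_abs, abs_mul]
          gcongr
          exact abs_intervalIntegral_le (fun y => hvC y t) 0 x
        · have := (hχ.deriv.integrable_mul
            (F := fun x => C * |x - 0|) (by fun_prop : Continuous _).locallyIntegrable).abs
          refine this.congr (Eventually.of_forall fun x => ?_)
          simp only [abs_mul, abs_abs, abs_of_nonneg hC0]
      simpa using this)
  filter_upwards [htime] with t ht ht0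
  have h1 := ht ht0
  have hswap : ∫ s in (0 : ℝ)..t, ∫ x, deriv χ x * g x s
      = ∫ x, deriv χ x * ∫ s in (0 : ℝ)..t, g x s := by
    rw [intervalIntegral_integral_swap]
    · simp only [intervalIntegral.integral_const_mul]
    · have h2 := integrable_mul_mul_of_abs_le (b := fun _ => 1) (μ := volume.restrict (uIoc 0 t)) hg hgC
        hχ.deriv.integrable (by
          rw [← IntegrableOn, ← intervalIntegrable_iff]
          exact intervalIntegrable_const)
      refine h2.swap.congr (Eventually.of_forall fun p => ?_)
      simp [Function.uncurry, mul_comm]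
  rw [hswap, hχ.integral_mul_eq_neg (hvl t) 0] at h1
  simp only [mul_add]
  rw [integral_add (hχ.deriv.integrable_mul (hQ t)) (hχ.deriv.integrable_mul (hP t))]
  linarith

theorem integrable_exp_neg_mul_abs {κ : ℝ} (hκ : 0 < κ) :
    Integrable fun x : ℝ => Real.exp (-(κ * |x|)) := by
  rw [← integrableOn_univ, ← Iic_union_Ioi (a := (0 : ℝ)), integrableOn_union]
  constructor
  · refine (integrableOn_exp_mul_Iic hκ 0).congr_fun (fun x hx => ?_) measurableSet_Iic
    simp only [abs_of_nonpos (mem_Iic.1 hx), mul_neg, neg_neg]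
  · refine (integrableOn_exp_mul_Ioi (neg_lt_zero.2 hκ) 0).congr_fun (fun x hx => ?_)
      measurableSet_Ioi
    simp only [abs_of_pos (mem_Ioi.1 hx), neg_mul]

theorem abs_exp_neg_mul_abs_sub_le {κ k : ℝ} (hκ : 0 < κ) (hk : 0 ≤ k) (x : ℝ) :
    |Real.exp (-(κ * |x - k|)) - Real.exp (-(κ * |x|))|
      ≤ Real.exp (-(κ * |x|)) * (Real.exp (κ * k) - 1) := by
  have h1 : |x| ≤ |x - k| + k := by
    have := abs_add_le (x - k) k
    rwa [sub_add_cancel, abs_of_nonneg hk] at this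
  have h2 : |x - k| ≤ |x| + k := by
    have := abs_sub x k
    rwa [abs_of_nonneg hk] at this
  have h3 : Real.exp (-(κ * |x - k|)) ≤ Real.exp (-(κ * |x|)) * Real.exp (κ * k) := by
    rw [← Real.exp_add]
    apply Real.exp_le_exp.2
    nlinarith
  have h4 : Real.exp (-(κ * |x|)) * Real.exp (-(κ * k)) ≤ Real.exp (-(κ * |x - k|)) := by
    rw [← Real.exp_add]
    apply Real.exp_le_exp.2
    nlinarith
  have h5 : 2 ≤ Real.exp (κ * k) + Real.exp (-(κ * k)) := by
    linarith [Real.add_one_le_exp (κ * k), Real.add_one_le_exp (-(κ * k))]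
  have h6 := Real.exp_pos (-(κ * |x|))
  rw [abs_le]
  constructor <;> nlinarith

theorem hasDerivAt_posPart_sq (s : ℝ) : HasDerivAt (fun s : ℝ => max s 0 ^ 2) (2 * max s 0) s := by
  rw [hasDerivAt_iff_isLittleO]
  refine Asymptotics.IsBigO.trans_isLittleO (Asymptotics.IsBigO.of_bound 1
    (Eventually.of_forall fun y => ?_)) (Asymptotics.isLittleO_pow_sub_sub s one_lt_two)
  rw [one_mul, norm_pow, norm_norm, Real.norm_eq_abs, Real.norm_eq_abs, sq_abs, smul_eq_mul,
    abs_le]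
  rcases le_total y 0 with hy | hy <;> rcases le_total s 0 with hs | hs <;>
    simp only [max_eq_left, max_eq_right, hy, hs] <;> constructor <;> nlinarith

theorem abs_posPart_sq_sub_le {D a b : ℝ} (ha : |a| ≤ D) (hb : |b| ≤ D) :
    |max a 0 ^ 2 - max b 0 ^ 2| ≤ 2 * D * |a - b| := by
  have h1 : |max a 0 - max b 0| ≤ |a - b| := abs_max_sub_max_le_abs a b 0
  have h2 : |max a 0 + max b 0| ≤ 2 * D := by
    have hD : 0 ≤ D := (abs_nonneg a).trans ha
    have h3 : max a 0 ≤ D := max_le ((le_abs_self a).trans ha) hD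
    have h4 : max b 0 ≤ D := max_le ((le_abs_self b).trans hb) hD
    rw [abs_of_nonneg (add_nonneg (le_max_right _ _) (le_max_right _ _))]
    linarith
  rw [sq_sub_sq, abs_mul]
  exact mul_le_mul h2 h1 (abs_nonneg _) ((abs_nonneg _).trans h2)

/-- Transport with a one-sided Lipschitz velocity `b` increases the weighted integral of
`(w⁺)²` at rate at most `1 / t + κ B`. -/
theorem neg_integral_transport_le {b v w : ℝ → ℝ} {B C D c κ t : ℝ} (hκ : 0 < κ)
    (hb : Measurable b) (hbB : ∀ x, |b x| ≤ B)
    (hOl : ∀ x y, x < y → b y - b x ≤ (y - x) / t)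
    (hv : Measurable v) (hvC : ∀ x, |v x| ≤ C)
    (hw : ∀ x, w x = c + ∫ y in (0 : ℝ)..x, v y) (hwD : ∀ x, |w x| ≤ D) :
    -∫ x, Real.exp (-(κ * |x|)) * (2 * max (w x) 0 * (b x * v x))
      ≤ (1 / t + κ * B) * ∫ x, Real.exp (-(κ * |x|)) * max (w x) 0 ^ 2 := by
  have hvl := hv.locallyIntegrable_of_abs_le hvC
  have hζ := integrable_exp_neg_mul_abs hκ
  have hζc : Continuous fun x : ℝ => Real.exp (-(κ * |x|)) := by fun_prop
  have hwc : Continuous w := by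
    rw [show w = fun x => c + ∫ y in (0 : ℝ)..x, v y from funext hw]
    exact continuous_const.add
      (intervalIntegral.continuous_primitive hvl.intervalIntegrable' 0)
  have hB : 0 ≤ B := (abs_nonneg _).trans (hbB 0)
  have hD : 0 ≤ D := (abs_nonneg _).trans (hwD 0)
  have hβc : Continuous fun x => max (w x) 0 ^ 2 := (hwc.max continuous_const).pow 2
  have hβD : ∀ x, |max (w x) 0 ^ 2| ≤ D ^ 2 := fun x => by
    rw [abs_of_nonneg (sq_nonneg _)]
    exact pow_le_pow_left₀ (le_max_right _ _) (max_le ((le_abs_self _).trans (hwD x)) hD) 2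
  have hJint : Integrable fun x => Real.exp (-(κ * |x|)) * max (w x) 0 ^ 2 :=
    hζ.mul_bdd hβc.aestronglyMeasurable (Eventually.of_forall hβD)
  have hdiff : ∀ x y, |w y - w x| ≤ C * |y - x| := fun x y => by
    rw [hw, hw, add_sub_add_left_eq_sub,
      intervalIntegral.integral_interval_sub_left (hvl.intervalIntegrable' _ _)
        (hvl.intervalIntegrable' _ _)]
    exact abs_intervalIntegral_le hvC x y
  have hlim : Tendsto (fun k : ℝ => ∫ x, Real.exp (-(κ * |x|)) * b x *
      (k⁻¹ * (max (w (x + k)) 0 ^ 2 - max (w x) 0 ^ 2))) (𝓝[>] 0)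
      (𝓝 (∫ x, Real.exp (-(κ * |x|)) * b x * (2 * max (w x) 0 * v x))) := by
    refine tendsto_integral_filter_of_dominated_convergence
      (fun x => Real.exp (-(κ * |x|)) * (B * (2 * D * C))) (Eventually.of_forall fun k => ?_) ?_
      (hζ.mul_const _) ?_
    · exact ((hζc.measurable.mul hb).mul (((hβc.comp (continuous_id.add continuous_const)).sub
        hβc).measurable.const_mul _)).aestronglyMeasurable
    · filter_upwards [self_mem_nhdsWithin] with k (hk : 0 < k)
      refine Eventually.of_forall fun x => ?_
      rw [Real.norm_eq_abs, abs_mul, abs_mul, abs_mul, abs_of_pos (Real.exp_pos _), mul_assoc]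
      have h1 := abs_posPart_sq_sub_le (hwD (x + k)) (hwD x)
      have h2 := hdiff x (x + k)
      rw [add_sub_cancel_left, abs_of_pos hk] at h2
      have h3 : |k⁻¹| * |max (w (x + k)) 0 ^ 2 - max (w x) 0 ^ 2| ≤ 2 * D * C := by
        rw [abs_of_pos (inv_pos.2 hk), inv_mul_le_iff₀ hk]
        calc _ ≤ 2 * D * |w (x + k) - w x| := h1
          _ ≤ 2 * D * (C * k) := by gcongr
          _ = k * (2 * D * C) := by ring
      gcongr
      exact hbB x
    · filter_upwards [_root_.LocallyIntegrable.ae_hasDerivAt_integral hvl] with x hx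
      have h1 : HasDerivAt w (v x) x := by
        rw [show w = fun x => c + ∫ y in (0 : ℝ)..x, v y from funext hw]
        exact (hx 0).const_add c
      have h2 : HasDerivAt (fun y => max (w y) 0 ^ 2) (2 * max (w x) 0 * v x) x :=
        (hasDerivAt_posPart_sq (w x)).comp x h1
      exact h2.tendsto_slope_zero_right.const_mul _
  have hexp : Tendsto (fun k : ℝ => k⁻¹ * (Real.exp (κ * k) - 1)) (𝓝[>] 0) (𝓝 κ) := by
    have h1 : HasDerivAt (fun k : ℝ => Real.exp (κ * k)) κ 0 := by
      simpa using ((hasDerivAt_id (0 : ℝ)).const_mul κ).exp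
    simpa using h1.tendsto_slope_zero_right
  set J := ∫ x, Real.exp (-(κ * |x|)) * max (w x) 0 ^ 2 with hJ
  have hbound : ∀ᶠ k : ℝ in 𝓝[>] 0,
      -((1 / t + B * (k⁻¹ * (Real.exp (κ * k) - 1))) * J)
        ≤ ∫ x, Real.exp (-(κ * |x|)) * b x *
          (k⁻¹ * (max (w (x + k)) 0 ^ 2 - max (w x) 0 ^ 2)) := by
    filter_upwards [self_mem_nhdsWithin] with k (hk : 0 < k)
    have hint : Integrable fun x => Real.exp (-(κ * |x|)) * b x * max (w x) 0 ^ 2 := by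
      refine (hJint.bdd_mul hb.aestronglyMeasurable (Eventually.of_forall hbB)).congr
        (Eventually.of_forall fun x => ?_)
      change b x * _ = _
      ring
    have hint' : Integrable fun x => Real.exp (-(κ * |x - k|)) * b (x - k) * max (w x) 0 ^ 2 := by
      have hbk : Measurable fun x => b (x - k) := hb.comp (measurable_id.sub_const k)
      refine ((hζ.comp_sub_right k).bdd_mul (f := fun x => b (x - k) * max (w x) 0 ^ 2)
        (c := B * D ^ 2) (hbk.mul hβc.measurable).aestronglyMeasurable
        (Eventually.of_forall fun x => ?_)).congr (Eventually.of_forall fun x => ?_)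
      · rw [Real.norm_eq_abs, abs_mul]
        exact mul_le_mul (hbB _) (hβD x) (abs_nonneg _) hB
      · change b (x - k) * _ * _ = _
        ring
    have hshift : ∫ x, Real.exp (-(κ * |x|)) * b x * max (w (x + k)) 0 ^ 2
        = ∫ x, Real.exp (-(κ * |x - k|)) * b (x - k) * max (w x) 0 ^ 2 := by
      rw [← integral_sub_right_eq_self _ k]
      simp only [sub_add_cancel]
    have hint'' : Integrable fun x => Real.exp (-(κ * |x|)) * b x * max (w (x + k)) 0 ^ 2 := by
      have := hint'.comp_add_right k
      simpa only [add_sub_cancel_right] using this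
    have heq : ∫ x, Real.exp (-(κ * |x|)) * b x *
          (k⁻¹ * (max (w (x + k)) 0 ^ 2 - max (w x) 0 ^ 2))
        = k⁻¹ * ∫ x, (Real.exp (-(κ * |x - k|)) * b (x - k) * max (w x) 0 ^ 2
          - Real.exp (-(κ * |x|)) * b x * max (w x) 0 ^ 2) := by
      rw [integral_sub hint' hint, ← hshift, ← integral_sub hint'' hint, ← integral_const_mul]
      congr 1
      ext x
      ring
    rw [heq, hJ, ← neg_mul, ← integral_const_mul, ← integral_const_mul]
    refine integral_mono (hJint.const_mul _) ((hint'.sub hint).const_mul _) fun x => ?_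
    have h1 := abs_le.1 (abs_exp_neg_mul_abs_sub_le hκ hk.le x)
    have h2 := hOl (x - k) x (by linarith)
    rw [sub_sub_cancel] at h2
    have h3 := abs_le.1 (hbB (x - k))
    set Z := Real.exp (-(κ * |x|)) with hZ
    set Z' := Real.exp (-(κ * |x - k|)) with hZ'
    set E := Real.exp (κ * k) - 1 with hE
    have hZ0 : 0 < Z := Real.exp_pos _
    have h4 : -(Z * E * B) ≤ (Z' - Z) * b (x - k) := by
      have h5 : |(Z' - Z) * b (x - k)| ≤ Z * E * B := by
        rw [abs_mul]
        exact mul_le_mul (abs_le.2 h1) (hbB _) (abs_nonneg _)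
          ((abs_nonneg _).trans (abs_le.2 h1))
      exact (abs_le.1 h5).1
    have h6 : -(Z * (k / t)) ≤ Z * (b (x - k) - b x) := by nlinarith
    have h7 : 0 ≤ max (w x) 0 ^ 2 := sq_nonneg _
    have h8 : -(k / t + E * B) * Z ≤ Z' * b (x - k) - Z * b x := by linarith
    have h9 := mul_le_mul_of_nonneg_left (mul_le_mul_of_nonneg_right h8 h7) (inv_pos.2 hk).le
    calc _ = k⁻¹ * (-(k / t + E * B) * Z * max (w x) 0 ^ 2) := by
          field_simp
      _ ≤ _ := h9
      _ = _ := by ring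
  have hfin := le_of_tendsto_of_tendsto
    (((tendsto_const_nhds.add (hexp.const_mul B)).mul_const J).neg) hlim hbound
  have hre : ∫ x, Real.exp (-(κ * |x|)) * b x * (2 * max (w x) 0 * v x)
      = ∫ x, Real.exp (-(κ * |x|)) * (2 * max (w x) 0 * (b x * v x)) := by
    congr 1
    ext x
    ring
  rw [hre] at hfin
  rw [mul_comm κ B]
  linarith

theorem posPart_neg_primitive_sq_eq {g : ℝ → ℝ} {C : ℝ} (hg : Measurable g)
    (hgC : ∀ s, |g s| ≤ C) (t : ℝ) :
    max (-∫ r in (0 : ℝ)..t, g r) 0 ^ 2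
      = ∫ s in (0 : ℝ)..t, 2 * max (-∫ r in (0 : ℝ)..s, g r) 0 * -g s := by
  have hgl := hg.locallyIntegrable_of_abs_le hgC
  have hC : 0 ≤ C := (abs_nonneg _).trans (hgC 0)
  have hlip : LipschitzWith C.toNNReal fun s => max (-∫ r in (0 : ℝ)..s, g r) 0 := by
    refine LipschitzWith.of_dist_le_mul fun x y => ?_
    rw [Real.dist_eq, Real.dist_eq, Real.coe_toNNReal _ hC]
    refine (abs_max_sub_max_le_abs _ _ _).trans ?_
    rw [neg_sub_neg, intervalIntegral.integral_interval_sub_left (hgl.intervalIntegrable' _ _)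
      (hgl.intervalIntegrable' _ _), abs_sub_comm]
    simpa only [abs_sub_comm x y] using abs_intervalIntegral_le hgC x y
  have hac : AbsolutelyContinuousOnInterval (fun s => max (-∫ r in (0 : ℝ)..s, g r) 0) 0 t :=
    (hlip.lipschitzOnWith).absolutelyContinuousOnInterval
  have key := (hac.fun_mul hac).integral_deriv_eq_sub
  simp only [intervalIntegral.integral_same, neg_zero, max_self, mul_zero, sub_zero] at key
  rw [sq, ← key]
  refine intervalIntegral.integral_congr_ae ?_
  filter_upwards [_root_.LocallyIntegrable.ae_hasDerivAt_integral hgl] with s hs _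
  have h1 := (hasDerivAt_posPart_sq (-∫ r in (0 : ℝ)..s, g r)).comp s (hs 0).neg
  rw [← h1.deriv]
  congr 1
  ext y
  exact (sq _).symm

/-- Comparison: if the flux `g` dominates `b v` for a one-sided Lipschitz velocity `b`, the flux
primitive is nonnegative. -/
theorem ae_zero_le_flux_primitive {v g b : ℝ → ℝ → ℝ} {B C : ℝ} (hB : 0 < B)
    (hv : Measurable fun p : ℝ × ℝ => v p.1 p.2) (hg : Measurable fun p : ℝ × ℝ => g p.1 p.2)
    (hb : Measurable fun p : ℝ × ℝ => b p.1 p.2)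
    (hvC : ∀ x t, |v x t| ≤ C) (hgC : ∀ x t, |g x t| ≤ C) (hbB : ∀ x t, |b x t| ≤ B)
    (hbv : ∀ x t, b x t * v x t ≤ g x t)
    (hOl : ∀ t, 0 < t → ∀ x y, x < y → b y t - b x t ≤ (y - x) / t)
    (hpot : ∀ᵐ t, 0 < t → ∃ c, ∀ᵐ x,
      (∫ s in (0 : ℝ)..t, g x s) + ∫ y in (0 : ℝ)..x, v y t = c)
    {T : ℝ} (hT : 0 < T) : ∀ᵐ x, 0 ≤ ∫ s in (0 : ℝ)..T, g x s := by
  have hslice : ∀ {w : ℝ → ℝ → ℝ}, (Measurable fun p : ℝ × ℝ => w p.1 p.2) →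
      ∀ t, Measurable fun x => w x t := fun hw t => hw.comp (measurable_id.prodMk measurable_const)
  have hC : 0 ≤ C := (abs_nonneg _).trans (hvC 0 0)
  set κ : ℝ := 1 / (2 * B * T) with hκdef
  have hκ : 0 < κ := by positivity
  have hζ := integrable_exp_neg_mul_abs hκ
  have hQ := measurable_intervalIntegral_right hg
  have hQs : ∀ t, Measurable fun x => -∫ s in (0 : ℝ)..t, g x s := fun t =>
    (hQ.comp (measurable_id.prodMk measurable_const)).neg
  have hQC : ∀ x t, 0 ≤ t → |-∫ s in (0 : ℝ)..t, g x s| ≤ C * t := fun x t ht => by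
    rw [abs_neg]
    simpa [abs_of_nonneg ht] using abs_intervalIntegral_le (hgC x) 0 t
  have hmaxC : ∀ x t, 0 ≤ t → max (-∫ s in (0 : ℝ)..t, g x s) 0 ≤ C * t := fun x t ht =>
    max_le ((le_abs_self _).trans (hQC x t ht)) (by positivity)
  set J : ℝ → ℝ := fun t =>
    ∫ x, Real.exp (-(κ * |x|)) * max (-∫ s in (0 : ℝ)..t, g x s) 0 ^ 2
  have hJint : ∀ t, 0 ≤ t → Integrable fun x =>
      Real.exp (-(κ * |x|)) * max (-∫ s in (0 : ℝ)..t, g x s) 0 ^ 2 := fun t ht =>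
    hζ.mul_bdd (c := (C * t) ^ 2)
      (((hQs t).max measurable_const).pow_const 2).aestronglyMeasurable
      (Eventually.of_forall fun x => by
        rw [Real.norm_eq_abs, abs_of_nonneg (sq_nonneg _)]
        exact pow_le_pow_left₀ (le_max_right _ _) (hmaxC x t ht) 2)
  have hinner : ∀ᵐ s, 0 < s →
      ∫ x, Real.exp (-(κ * |x|)) * (2 * max (-∫ r in (0 : ℝ)..s, g x r) 0 * -g x s)
        ≤ (1 / s + κ * B) * J s := by
    filter_upwards [hpot] with s hs hs0
    obtain ⟨c, hc⟩ := hs hs0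
    set w : ℝ → ℝ := fun x => -c + ∫ y in (0 : ℝ)..x, v y s with hw
    have hwQ : ∀ᵐ x, -∫ r in (0 : ℝ)..s, g x r = w x := by
      filter_upwards [hc] with x hx
      simp only [hw]
      linarith
    have hvs := hslice hv s
    have hwc : Continuous w := continuous_const.add (intervalIntegral.continuous_primitive
      (hvs.locallyIntegrable_of_abs_le fun x => hvC x s).intervalIntegrable' 0)
    have hwD : ∀ x, |w x| ≤ C * s := by
      have hopen : IsOpen {x | C * s < |w x|} := isOpen_lt continuous_const hwc.abs
      have hnull : volume {x | C * s < |w x|} = 0 := by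
        have : ∀ᵐ x, |w x| ≤ C * s := by
          filter_upwards [hwQ] with x hx
          rw [← hx]
          exact hQC x s hs0.le
        simpa only [ae_iff, not_le] using this
      intro x
      by_contra hx
      have hx' : x ∈ {x | C * s < |w x|} := not_le.1 hx
      rw [hopen.measure_eq_zero_iff volume] at hnull
      rw [hnull] at hx'
      exact hx'
    have key := neg_integral_transport_le (w := w) hκ (hslice hb s) (fun x => hbB x s) (hOl s hs0) hvs
      (fun x => hvC x s) (fun x => rfl) hwD
    have hJw : J s = ∫ x, Real.exp (-(κ * |x|)) * max (w x) 0 ^ 2 :=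
      integral_congr_ae (by filter_upwards [hwQ] with x hx; rw [hx])
    rw [hJw]
    refine le_trans ?_ key
    rw [← integral_neg]
    have hwm : ∀ x, |2 * max (w x) 0| ≤ 2 * (C * s) := fun x => by
      rw [abs_of_nonneg (by positivity)]
      have : max (w x) 0 ≤ C * s := max_le ((le_abs_self _).trans (hwD x)) (by positivity)
      linarith
    have hwmeas : Measurable fun x => 2 * max (w x) 0 :=
      ((hwc.max continuous_const).measurable).const_mul 2
    refine integral_mono_ae ?_ ?_ ?_
    · refine hζ.mul_bdd (c := 2 * (C * s) * C) ((((hQs s).max measurable_const).const_mul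
        2).mul (hslice hg s).neg).aestronglyMeasurable (Eventually.of_forall fun x => ?_)
      rw [Real.norm_eq_abs, abs_mul, abs_neg, abs_of_nonneg (by positivity)]
      exact mul_le_mul (by linarith [hmaxC x s hs0.le]) (hgC x s) (abs_nonneg _) (by positivity)
    · refine (hζ.mul_bdd (c := 2 * (C * s) * (B * C)) (hwmeas.mul ((hslice hb s).mul
        hvs)).aestronglyMeasurable (Eventually.of_forall fun x => ?_)).neg
      change |2 * max (w x) 0 * (b x s * v x s)| ≤ _
      rw [abs_mul, abs_mul (b x s)]
      exact mul_le_mul (hwm x) (mul_le_mul (hbB x s) (hvC x s) (abs_nonneg _) hB.le)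
        (by positivity) (by positivity)
    · filter_upwards [hwQ] with x hx
      rw [hx, ← mul_neg, ← mul_neg]
      have h0 : 0 ≤ max (w x) 0 := le_max_right _ _
      have h1 := hbv x s
      rw [← mul_neg]
      gcongr
  have htime : ∀ t, 0 < t → J t = (∫ s in (0 : ℝ)..t,
      ∫ x, Real.exp (-(κ * |x|)) * (2 * max (-∫ r in (0 : ℝ)..s, g x r) 0 * -g x s)) ∧
      IntervalIntegrable (fun s => ∫ x,
        Real.exp (-(κ * |x|)) * (2 * max (-∫ r in (0 : ℝ)..s, g x r) 0 * -g x s)) volume 0 t := by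
    intro t ht
    have hprod : Integrable (fun p : ℝ × ℝ => Real.exp (-(κ * |p.2|)) *
        (2 * max (-∫ r in (0 : ℝ)..p.1, g p.2 r) 0 * -g p.2 p.1))
        ((volume.restrict (uIoc 0 t)).prod volume) := by
      have h1 : Integrable (fun _ : ℝ => (1 : ℝ)) (volume.restrict (uIoc 0 t)) := by
        rw [← IntegrableOn, ← intervalIntegrable_iff]
        exact intervalIntegrable_const
      have h2 := h1.mul_prod hζ
      simp only [one_mul] at h2
      refine h2.mul_bdd (c := 2 * (C * t) * C) ?_ ?_
      · exact ((((hQ.comp measurable_swap).neg.max measurable_const).const_mul 2).mul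
          (hg.comp measurable_swap).neg).aestronglyMeasurable
      · have hmem : ∀ᵐ p : ℝ × ℝ ∂(volume.restrict (uIoc 0 t)).prod volume, p.1 ∈ uIoc 0 t :=
          Measure.quasiMeasurePreserving_fst.ae (ae_restrict_mem measurableSet_uIoc)
        filter_upwards [hmem] with p hp
        rw [uIoc_of_le ht.le] at hp
        rw [Real.norm_eq_abs, abs_mul, abs_neg, abs_of_nonneg (by positivity)]
        have h3 := hmaxC p.2 p.1 hp.1.le
        have h4 : C * p.1 ≤ C * t := mul_le_mul_of_nonneg_left hp.2 hC
        exact mul_le_mul (by linarith) (hgC _ _) (abs_nonneg _) (by positivity)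
    constructor
    · rw [intervalIntegral_integral_swap hprod]
      refine integral_congr_ae (Eventually.of_forall fun x => ?_)
      simp only [intervalIntegral.integral_const_mul]
      have hgx : Measurable (g x) := hg.comp (measurable_const.prodMk measurable_id)
      rw [posPart_neg_primitive_sq_eq hgx (hgC x) t]
    · rw [intervalIntegrable_iff]
      exact hprod.integral_prod_left
  set K : ℝ := (∫ x, Real.exp (-(κ * |x|))) * C ^ 2 with hK
  have hiter : ∀ n : ℕ, ∀ t, 0 < t → t ≤ T → J t ≤ K * (3 / 4) ^ n * t ^ 2 := by
    intro n
    induction n with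
    | zero =>
      intro t ht _
      rw [pow_zero, mul_one, hK, mul_assoc, ← mul_pow, ← integral_mul_const]
      refine integral_mono (hJint t ht.le) (hζ.mul_const _) fun x => ?_
      have h1 := pow_le_pow_left₀ (le_max_right _ _) (hmaxC x t ht.le) 2
      exact mul_le_mul_of_nonneg_left h1 (Real.exp_pos _).le
    | succ n ih =>
      intro t ht htT
      rw [(htime t ht).1]
      have hKn : 0 ≤ K * (3 / 4) ^ n :=
        mul_nonneg (mul_nonneg (integral_nonneg fun x => (Real.exp_pos _).le) (sq_nonneg C))
          (by positivity)
      have hmono : ∫ s in (0 : ℝ)..t,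
          ∫ x, Real.exp (-(κ * |x|)) * (2 * max (-∫ r in (0 : ℝ)..s, g x r) 0 * -g x s)
          ≤ ∫ s in (0 : ℝ)..t, 3 / 2 * (K * (3 / 4) ^ n) * s := by
        refine intervalIntegral.integral_mono_ae_restrict ht.le (htime t ht).2
          ((continuous_const.mul continuous_id).intervalIntegrable _ _) ?_
        have h0 : ∀ᵐ s, s ≠ (0 : ℝ) := by simp [ae_iff]
        filter_upwards [ae_restrict_of_ae hinner, ae_restrict_of_ae h0,
          ae_restrict_mem measurableSet_Icc] with s hs hs0 hsI
        have hspos : 0 < s := lt_of_le_of_ne hsI.1 (Ne.symm hs0)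
        refine (hs hspos).trans ?_
        have h1 := ih s hspos (hsI.2.trans htT)
        have h2 : 1 / s + κ * B ≤ 3 / 2 * (1 / s) := by
          have h3 : κ * B = 1 / 2 * (1 / T) := by
            rw [hκdef]
            field_simp
          have h4 : 1 / T ≤ 1 / s := one_div_le_one_div_of_le hspos (hsI.2.trans htT)
          linarith
        calc (1 / s + κ * B) * J s ≤ (1 / s + κ * B) * (K * (3 / 4) ^ n * s ^ 2) := by
              gcongr
          _ ≤ 3 / 2 * (1 / s) * (K * (3 / 4) ^ n * s ^ 2) := by gcongr
          _ = 3 / 2 * (K * (3 / 4) ^ n) * s := by field_simp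
      refine hmono.trans (le_of_eq ?_)
      rw [intervalIntegral.integral_const_mul, integral_id]
      ring
  have hlim : Tendsto (fun n : ℕ => K * (3 / 4 : ℝ) ^ n * T ^ 2) atTop (𝓝 0) := by
    simpa using ((tendsto_pow_atTop_nhds_zero_of_lt_one (r := (3 / 4 : ℝ)) (by norm_num)
      (by norm_num)).const_mul K).mul_const (T ^ 2)
  have hJle : J T ≤ 0 := ge_of_tendsto' hlim fun n => hiter n T hT le_rfl
  have hnn : ∀ x, 0 ≤ Real.exp (-(κ * |x|)) * max (-∫ s in (0 : ℝ)..T, g x s) 0 ^ 2 := fun x =>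
    mul_nonneg (Real.exp_pos _).le (sq_nonneg _)
  have hJ0 : J T = 0 := le_antisymm hJle (integral_nonneg hnn)
  filter_upwards [(integral_eq_zero_iff_of_nonneg hnn (hJint T hT.le)).1 hJ0] with x hx
  have h1 : max (-∫ s in (0 : ℝ)..T, g x s) 0 = 0 := by
    have := (mul_eq_zero.1 hx).resolve_left (Real.exp_ne_zero _)
    exact pow_eq_zero_iff two_ne_zero |>.1 this
  linarith [max_eq_right_iff.1 h1]

/-- If the flux primitives of `g` vanish, then `v` vanishes. -/
theorem ae_eq_zero_of_flux_primitive_eq_zero {v g : ℝ → ℝ → ℝ} {C : ℝ}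
    (hv : Measurable fun p : ℝ × ℝ => v p.1 p.2) (hvC : ∀ x t, |v x t| ≤ C)
    (hpot : ∀ᵐ t, 0 < t → ∃ c, ∀ᵐ x,
      (∫ s in (0 : ℝ)..t, g x s) + ∫ y in (0 : ℝ)..x, v y t = c)
    (hzero : ∀ t, 0 < t → ∀ᵐ x, ∫ s in (0 : ℝ)..t, g x s = 0) :
    ∀ᵐ p : ℝ × ℝ, 0 < p.2 → v p.1 p.2 = 0 := by
  have hslice : ∀ᵐ t, ∀ᵐ x, 0 < t → v x t = 0 := by
    filter_upwards [hpot] with t ht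
    by_cases ht0 : 0 < t
    swap
    · exact Eventually.of_forall fun x hx => absurd hx ht0
    obtain ⟨c, hc⟩ := ht ht0
    have hvl : LocallyIntegrable fun x => v x t :=
      (hv.comp (measurable_id.prodMk measurable_const)).locallyIntegrable_of_abs_le
        fun x => hvC x t
    have hprim : (fun x => ∫ y in (0 : ℝ)..x, v y t) = fun _ => c := by
      refine Measure.eq_of_ae_eq (μ := volume) ?_
        (intervalIntegral.continuous_primitive hvl.intervalIntegrable' 0) continuous_const
      filter_upwards [hc, hzero t ht0] with x hx1 hx2
      linarith
    filter_upwards [_root_.LocallyIntegrable.ae_hasDerivAt_integral hvl] with x hx _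
    have h1 := hx 0
    rw [hprim] at h1
    exact h1.unique (hasDerivAt_const x c)
  have hmeas : MeasurableSet {p : ℝ × ℝ | 0 < p.1 → v p.2 p.1 = 0} := by
    have h1 : MeasurableSet {p : ℝ × ℝ | 0 < p.1} := measurableSet_lt measurable_const measurable_fst
    have h2 : MeasurableSet {p : ℝ × ℝ | v p.2 p.1 = 0} :=
      (hv.comp measurable_swap) (measurableSet_singleton 0)
    exact h1.imp h2
  have hswap : ∀ᵐ p ∂(volume : Measure ℝ).prod (volume : Measure ℝ),
      0 < p.1 → v p.2 p.1 = 0 := (Measure.ae_prod_iff_ae_ae hmeas).2 hslice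
  have := (Measure.measurePreserving_swap (μ := (volume : Measure ℝ))
    (ν := (volume : Measure ℝ))).quasiMeasurePreserving.ae hswap
  exact this

/-- Bounded weak solutions of `vₜ + gₓ = 0` with zero initial trace vanish, provided that the flux
`g` is squeezed between `b₂ v` and `b₁ v` for one-sided Lipschitz velocities `b₁`, `b₂`. -/
theorem ae_eq_zero_of_oneSidedLipschitz {v g b₁ b₂ : ℝ → ℝ → ℝ} {B C : ℝ} (hB : 0 < B)
    (hv : Measurable fun p : ℝ × ℝ => v p.1 p.2) (hg : Measurable fun p : ℝ × ℝ => g p.1 p.2)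
    (hb₁ : Measurable fun p : ℝ × ℝ => b₁ p.1 p.2) (hb₂ : Measurable fun p : ℝ × ℝ => b₂ p.1 p.2)
    (hvC : ∀ x t, |v x t| ≤ C) (hgC : ∀ x t, |g x t| ≤ C)
    (hb₁B : ∀ x t, |b₁ x t| ≤ B) (hb₂B : ∀ x t, |b₂ x t| ≤ B)
    (hbv₁ : ∀ x t, g x t ≤ b₁ x t * v x t) (hbv₂ : ∀ x t, b₂ x t * v x t ≤ g x t)
    (hOl₁ : ∀ t, 0 < t → ∀ x y, x < y → b₁ y t - b₁ x t ≤ (y - x) / t)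
    (hOl₂ : ∀ t, 0 < t → ∀ x y, x < y → b₂ y t - b₂ x t ≤ (y - x) / t)
    (hweak : ∀ χ η, IsTestOn univ χ → IsTestOn (Ioi 0) η →
      ∫ x, ∫ t in Ioi (0 : ℝ), (v x t * (χ x * deriv η t) + g x t * (deriv χ x * η t)) = 0)
    (hinit : ∀ x₁ x₂ : ℝ, Tendsto (fun t => ∫ x in x₁..x₂, v x t) (𝓝[>] 0) (𝓝 0)) :
    ∀ᵐ p : ℝ × ℝ, 0 < p.2 → v p.1 p.2 = 0 := by
  have hpot := ae_flux_primitive_add_eq_const hv hg hvC hgC hweak hinit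
  have hpot' : ∀ᵐ t, 0 < t → ∃ c, ∀ᵐ x,
      (∫ s in (0 : ℝ)..t, -g x s) + ∫ y in (0 : ℝ)..x, -v y t = c := by
    filter_upwards [hpot] with t ht ht0
    obtain ⟨c, hc⟩ := ht ht0
    refine ⟨-c, ?_⟩
    filter_upwards [hc] with x hx
    rw [intervalIntegral.integral_neg, intervalIntegral.integral_neg, ← hx]
    ring
  refine ae_eq_zero_of_flux_primitive_eq_zero hv hvC hpot fun t ht => ?_
  filter_upwards [ae_zero_le_flux_primitive hB hv hg hb₂ hvC hgC hb₂B hbv₂ hOl₂ hpot ht,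
    ae_zero_le_flux_primitive (v := fun x t => -v x t) (g := fun x t => -g x t) hB hv.neg hg.neg
      hb₁ (fun x t => (abs_neg _).trans_le (hvC x t)) (fun x t => (abs_neg _).trans_le (hgC x t))
      hb₁B (fun x t => by linarith [hbv₁ x t]) hOl₁ hpot' ht] with x h1 h2
  rw [intervalIntegral.integral_neg] at h2
  linarith

theorem tangent_line_le {f : ℝ → ℝ} (hf : ContDiff ℝ 2 f)
    (hconv : ∀ u : ℝ, 0 ≤ deriv (deriv f) u) (a b : ℝ) :
    deriv f b * (a - b) ≤ f a - f b := by
  have hd : Differentiable ℝ f := hf.differentiable (by norm_num)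
  have hd' : Differentiable ℝ (deriv f) := by
    have : ContDiff ℝ (1 + 1) f := by
      norm_num
      exact hf
    exact (contDiff_succ_iff_deriv.1 this).2.2.differentiable (by norm_num)
  have hc : ConvexOn ℝ univ f := convexOn_univ_of_deriv2_nonneg hd hd' hconv
  rcases lt_trichotomy a b with h | h | h
  · have := hc.slope_le_deriv (mem_univ a) (mem_univ b) h (hd b)
    rw [slope_def_field, div_le_iff₀ (by linarith)] at this
    linarith
  · simp [h]
  · have := hc.deriv_le_slope (mem_univ b) (mem_univ a) h (hd b)
    rwa [slope_def_field, le_div_iff₀ (by linarith)] at this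

/-- Products of test functions are admissible in the weak formulation. -/
theorem weak_form_mul {u w : ℝ → ℝ → ℝ}
    (hweak : ∀ ϕ : ℝ × ℝ → ℝ, (∀ n : ℕ, ContDiff ℝ n ϕ) → HasCompactSupport ϕ →
      tsupport ϕ ⊆ (univ : Set ℝ) ×ˢ Ioi (0 : ℝ) →
      (∫ x : ℝ, ∫ t in Ioi (0 : ℝ),
        (u x t * deriv (fun τ : ℝ => ϕ (x, τ)) t
          + w x t * deriv (fun y : ℝ => ϕ (y, t)) x)) = 0)
    {χ η : ℝ → ℝ} (hχ : IsTestOn univ χ) (hη : IsTestOn (Ioi 0) η) :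
    ∫ x, ∫ t in Ioi (0 : ℝ), (u x t * (χ x * deriv η t) + w x t * (deriv χ x * η t)) = 0 := by
  have hsub : tsupport (fun p : ℝ × ℝ => χ p.1 * η p.2) ⊆ tsupport χ ×ˢ tsupport η := by
    refine closure_minimal (fun p hp => ⟨subset_tsupport _ (left_ne_zero_of_mul hp),
      subset_tsupport _ (right_ne_zero_of_mul hp)⟩)
      ((isClosed_tsupport _).prod (isClosed_tsupport _))
  have hcomp : IsCompact (tsupport χ ×ˢ tsupport η) :=
    hχ.compact.isCompact.prod hη.compact.isCompact
  have key := hweak (fun p => χ p.1 * η p.2)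
    (fun n => ((hχ.smooth.comp contDiff_fst).mul (hη.smooth.comp contDiff_snd)).of_le
      (by exact_mod_cast le_top))
    (hcomp.of_isClosed_subset (isClosed_tsupport _) hsub)
    (hsub.trans (prod_mono (subset_univ _) hη.subset))
  simpa only [deriv_const_mul_field, deriv_mul_const_field] using key

theorem weak_form_sub {u₁ u₂ w₁ w₂ : ℝ → ℝ → ℝ} {C : ℝ}
    (hu₁ : Measurable fun p : ℝ × ℝ => u₁ p.1 p.2) (hu₂ : Measurable fun p : ℝ × ℝ => u₂ p.1 p.2)
    (hw₁ : Measurable fun p : ℝ × ℝ => w₁ p.1 p.2) (hw₂ : Measurable fun p : ℝ × ℝ => w₂ p.1 p.2)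
    (hu₁C : ∀ x t, |u₁ x t| ≤ C) (hu₂C : ∀ x t, |u₂ x t| ≤ C)
    (hw₁C : ∀ x t, |w₁ x t| ≤ C) (hw₂C : ∀ x t, |w₂ x t| ≤ C)
    {χ η : ℝ → ℝ} (hχ : IsTestOn univ χ) (hη : IsTestOn (Ioi 0) η)
    (h₁ : ∫ x, ∫ t in Ioi (0 : ℝ),
      (u₁ x t * (χ x * deriv η t) + w₁ x t * (deriv χ x * η t)) = 0)
    (h₂ : ∫ x, ∫ t in Ioi (0 : ℝ),
      (u₂ x t * (χ x * deriv η t) + w₂ x t * (deriv χ x * η t)) = 0) :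
    ∫ x, ∫ t in Ioi (0 : ℝ), ((u₁ x t - u₂ x t) * (χ x * deriv η t)
      + (w₁ x t - w₂ x t) * (deriv χ x * η t)) = 0 := by
  have hint : ∀ {u w : ℝ → ℝ → ℝ}, (Measurable fun p : ℝ × ℝ => u p.1 p.2) →
      (Measurable fun p : ℝ × ℝ => w p.1 p.2) → (∀ x t, |u x t| ≤ C) → (∀ x t, |w x t| ≤ C) →
      Integrable (fun p : ℝ × ℝ => u p.1 p.2 * (χ p.1 * deriv η p.2)
        + w p.1 p.2 * (deriv χ p.1 * η p.2)) (volume.prod (volume.restrict (Ioi 0))) :=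
    fun hu hw huC hwC =>
      (integrable_mul_mul_of_abs_le hu huC hχ.integrable hη.deriv.integrable.restrict).add
        (integrable_mul_mul_of_abs_le hw hwC hχ.deriv.integrable hη.integrable.restrict)
  have hi₁ := hint hu₁ hw₁ hu₁C hw₁C
  have hi₂ := hint hu₂ hw₂ hu₂C hw₂C
  have h := integral_integral_sub hi₁ hi₂
  rw [h₁, h₂, sub_zero] at h
  refine Eq.trans (integral_congr_ae (Eventually.of_forall fun x => ?_)) h
  refine integral_congr_ae (Eventually.of_forall fun t => ?_)
  simp only
  ring

theorem exists_abs_comp_le {h : ℝ → ℝ} (hh : Continuous h) (R : ℝ) :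
    ∃ C, ∀ u, |u| ≤ R → |h u| ≤ C := by
  obtain ⟨C, hC⟩ := (isCompact_Icc (a := -R) (b := R)).exists_bound_of_continuousOn hh.continuousOn
  exact ⟨C, fun u hu => hC u (abs_le.1 hu)⟩

end

/-- uniqueness of bounded measurable weak solutions satisfying the
Oleinik one-sided inequality. -/
theorem stmt4_uniqueness_entropy_solutions
    (f φ : ℝ → ℝ) (M : ℝ)
    (hf : ContDiff ℝ 2 f)
    (hconv : ∀ u : ℝ, 0 ≤ deriv (deriv f) u)
    (hdeg : volume {u : ℝ | deriv (deriv f) u = 0} = 0)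
    (hφmeas : Measurable φ)
    (hφbdd : ∀ x : ℝ, |φ x| ≤ M)
    (u₁ u₂ : ℝ → ℝ → ℝ)
    (hmeas₁ : Measurable (fun p : ℝ × ℝ => u₁ p.1 p.2))
    (hmeas₂ : Measurable (fun p : ℝ × ℝ => u₂ p.1 p.2))
    (hbdd₁ : ∃ C : ℝ, ∀ x t : ℝ, |u₁ x t| ≤ C)
    (hbdd₂ : ∃ C : ℝ, ∀ x t : ℝ, |u₂ x t| ≤ C)
    (hweak₁ : ∀ ϕ : ℝ × ℝ → ℝ, (∀ n : ℕ, ContDiff ℝ n ϕ) → HasCompactSupport ϕ →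
      tsupport ϕ ⊆ (Set.univ : Set ℝ) ×ˢ Set.Ioi (0:ℝ) →
      (∫ x : ℝ, ∫ t in Set.Ioi (0:ℝ),
        (u₁ x t * deriv (fun τ : ℝ => ϕ (x, τ)) t
          + f (u₁ x t) * deriv (fun y : ℝ => ϕ (y, t)) x)) = 0)
    (hweak₂ : ∀ ϕ : ℝ × ℝ → ℝ, (∀ n : ℕ, ContDiff ℝ n ϕ) → HasCompactSupport ϕ →
      tsupport ϕ ⊆ (Set.univ : Set ℝ) ×ˢ Set.Ioi (0:ℝ) →
      (∫ x : ℝ, ∫ t in Set.Ioi (0:ℝ),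
        (u₂ x t * deriv (fun τ : ℝ => ϕ (x, τ)) t
          + f (u₂ x t) * deriv (fun y : ℝ => ϕ (y, t)) x)) = 0)
    (hinit₁ : ∀ x₁ x₂ : ℝ,
      Tendsto (fun t : ℝ => ∫ x in x₁..x₂, u₁ x t)
        (nhdsWithin 0 (Set.Ioi 0)) (nhds (∫ x in x₁..x₂, φ x)))
    (hinit₂ : ∀ x₁ x₂ : ℝ,
      Tendsto (fun t : ℝ => ∫ x in x₁..x₂, u₂ x t)
        (nhdsWithin 0 (Set.Ioi 0)) (nhds (∫ x in x₁..x₂, φ x)))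
    (holeinik₁ : ∀ t : ℝ, 0 < t → ∀ x₁ x₂ : ℝ, x₁ < x₂ →
      deriv f (u₁ x₂ t) - deriv f (u₁ x₁ t) ≤ (x₂ - x₁) / t)
    (holeinik₂ : ∀ t : ℝ, 0 < t → ∀ x₁ x₂ : ℝ, x₁ < x₂ →
      deriv f (u₂ x₂ t) - deriv f (u₂ x₁ t) ≤ (x₂ - x₁) / t) :
    ∀ᵐ p : ℝ × ℝ ∂volume, 0 < p.2 → u₁ p.1 p.2 = u₂ p.1 p.2 := by
  obtain ⟨C₁, hC₁⟩ := hbdd₁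
  obtain ⟨C₂, hC₂⟩ := hbdd₂
  have hR₁ : ∀ x t, |u₁ x t| ≤ max C₁ C₂ := fun x t => (hC₁ x t).trans (le_max_left _ _)
  have hR₂ : ∀ x t, |u₂ x t| ≤ max C₁ C₂ := fun x t => (hC₂ x t).trans (le_max_right _ _)
  have hf'c : Continuous (deriv f) := hf.continuous_deriv (by norm_num)
  obtain ⟨F, hF⟩ := exists_abs_comp_le hf.continuous (max C₁ C₂)
  obtain ⟨B, hB⟩ := exists_abs_comp_le hf'c (max C₁ C₂)
  set C := max (max C₁ C₂) F
  have hu₁C : ∀ x t, |u₁ x t| ≤ C := fun x t => (hR₁ x t).trans (le_max_left _ _)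
  have hu₂C : ∀ x t, |u₂ x t| ≤ C := fun x t => (hR₂ x t).trans (le_max_left _ _)
  have hf₁C : ∀ x t, |f (u₁ x t)| ≤ C := fun x t => (hF _ (hR₁ x t)).trans (le_max_right _ _)
  have hf₂C : ∀ x t, |f (u₂ x t)| ≤ C := fun x t => (hF _ (hR₂ x t)).trans (le_max_right _ _)
  have hfm₁ := hf.continuous.measurable.comp hmeas₁
  have hfm₂ := hf.continuous.measurable.comp hmeas₂
  have hsub : ∀ {a b : ℝ}, |a| ≤ C → |b| ≤ C → |a - b| ≤ 2 * C := fun ha hb =>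
    (abs_sub _ _).trans (by linarith)
  have hloc : ∀ {u : ℝ → ℝ → ℝ}, (Measurable fun p : ℝ × ℝ => u p.1 p.2) →
      (∀ x t, |u x t| ≤ C) → ∀ t x₁ x₂, IntervalIntegrable (fun x => u x t) volume x₁ x₂ :=
    fun hu huC t => ((hu.comp (measurable_id.prodMk
      measurable_const)).locallyIntegrable_of_abs_le fun x => huC x t).intervalIntegrable'
  have hzero := ae_eq_zero_of_oneSidedLipschitz (v := fun x t => u₁ x t - u₂ x t)
    (g := fun x t => f (u₁ x t) - f (u₂ x t)) (b₁ := fun x t => deriv f (u₁ x t))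
    (b₂ := fun x t => deriv f (u₂ x t)) (B := max B 1) (C := 2 * C)
    (lt_max_of_lt_right one_pos) (hmeas₁.sub hmeas₂) (hfm₁.sub hfm₂)
    (hf'c.measurable.comp hmeas₁) (hf'c.measurable.comp hmeas₂)
    (fun x t => hsub (hu₁C x t) (hu₂C x t)) (fun x t => hsub (hf₁C x t) (hf₂C x t))
    (fun x t => (hB _ (hR₁ x t)).trans (le_max_left _ _))
    (fun x t => (hB _ (hR₂ x t)).trans (le_max_left _ _))
    (fun x t => by linarith [tangent_line_le hf hconv (u₂ x t) (u₁ x t)])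
    (fun x t => tangent_line_le hf hconv (u₁ x t) (u₂ x t))
    holeinik₁ holeinik₂
    (fun χ η hχ hη => weak_form_sub hmeas₁ hmeas₂ hfm₁ hfm₂ hu₁C hu₂C hf₁C hf₂C hχ hη
      (weak_form_mul (w := fun x t => f (u₁ x t)) hweak₁ hχ hη)
      (weak_form_mul (w := fun x t => f (u₂ x t)) hweak₂ hχ hη))
    (fun x₁ x₂ => by
      have h := (hinit₁ x₁ x₂).sub (hinit₂ x₁ x₂)
      rw [sub_self] at h
      refine h.congr fun t => ?_
      exact (intervalIntegral.integral_sub (hloc hmeas₁ hu₁C t x₁ x₂)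
        (hloc hmeas₂ hu₂C t x₁ x₂)).symm)
  filter_upwards [hzero] with p hp hp0
  exact sub_eq_zero.1 (hp hp0)
end

section
/- (Refined semigroup property.) Fix τ > 0. For t > τ, x ∈ ℝ and v ∈ ℝ define E_τ(v;x,t) := (t−τ) · ∫₀^v f''(s) · ( u⁺(x − (t−τ)·f'(s), τ) − s ) ds, and let 𝒰_τ(x,t) := {w ∈ ℝ : E_τ(v;x,t) ≤ E_τ(w;x,t) for all v ∈ ℝ}. Then 𝒰_τ(x,t) = 𝒰(x,t) for every x ∈ ℝ and every t > τ; in particular sup 𝒰_τ(x,t) = u⁻(x,t) and inf 𝒰_τ(x,t) = u⁺(x,t), i.e., restarting the solution formula at time τ from the profile u⁺(·,τ) reproduces the same solution. -/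
open MeasureTheory Filter Set

noncomputable def eTau (f φ : ℝ → ℝ) (τ v x t : ℝ) : ℝ :=
  (t - τ) * (∫ s in (0:ℝ)..v,
    deriv (deriv f) s * (uPlus f φ (x - (t - τ) * deriv f s) τ - s))

def maxSetTau (f φ : ℝ → ℝ) (τ x t : ℝ) : Set ℝ :=
  {w : ℝ | ∀ v : ℝ, eTau f φ τ v x t ≤ eTau f φ τ w x t}

/-- The Legendre transform of `f`, evaluated at the slope `f'(u)`. -/
noncomputable def legendreAt (f : ℝ → ℝ) (u : ℝ) : ℝ := u * deriv f u - f u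

/-- The Hopf–Lax cost of reaching `x` in time `c` with speed `f'(u)` from the potential `P`. -/
noncomputable def hopfLaxCost (f P : ℝ → ℝ) (c x u : ℝ) : ℝ :=
  P (x - c * deriv f u) + c * legendreAt f u

lemma ContDiff.hasDerivAt_deriv_of_two {f : ℝ → ℝ} (hf : ContDiff ℝ 2 f) (u : ℝ) :
    HasDerivAt (deriv f) (deriv (deriv f) u) u :=
  (((contDiff_succ_iff_deriv (n := 1)).1 hf).2.2.differentiable one_ne_zero u).hasDerivAt

lemma ContDiff.continuous_deriv_deriv_of_two {f : ℝ → ℝ} (hf : ContDiff ℝ 2 f) :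
    Continuous (deriv (deriv f)) :=
  ((contDiff_succ_iff_deriv (n := 1)).1 hf).2.2.continuous_deriv le_rfl

lemma strictMono_deriv_of_deriv2_nonneg {f : ℝ → ℝ} (hf : ContDiff ℝ 2 f)
    (hconv : ∀ u, 0 ≤ deriv (deriv f) u) (hdeg : volume {u | deriv (deriv f) u = 0} = 0) :
    StrictMono (deriv f) := by
  have hmono : Monotone (deriv f) :=
    monotone_of_deriv_nonneg (fun u => (hf.hasDerivAt_deriv_of_two u).differentiableAt) hconv
  refine hmono.strictMono_of_injective fun a b hab => ?_
  by_contra hne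
  wlog hlt : a < b generalizing a b
  · exact this b a hab.symm (Ne.symm hne) (lt_of_le_of_ne (not_lt.1 hlt) (Ne.symm hne))
  have hsub : Ioo a b ⊆ {u | deriv (deriv f) u = 0} := by
    intro u hu
    have hev : deriv f =ᶠ[nhds u] fun _ => deriv f a := by
      filter_upwards [Ioo_mem_nhds hu.1 hu.2] with y hy
      exact le_antisymm ((hmono hy.2.le).trans hab.ge) (hmono hy.1.le)
    simp [hev.deriv_eq]
  have h0 := measure_mono_null hsub hdeg
  rw [Real.volume_Ioo, ENNReal.ofReal_eq_zero] at h0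
  linarith

lemma hasDerivAt_legendreAt {f : ℝ → ℝ} (hf : ContDiff ℝ 2 f) (u : ℝ) :
    HasDerivAt (legendreAt f) (u * deriv (deriv f) u) u := by
  have h1 := (hasDerivAt_id u).mul (hf.hasDerivAt_deriv_of_two u)
  have h2 := (hf.differentiable two_ne_zero u).hasDerivAt
  refine (h1.sub h2).congr_deriv ?_
  simp

lemma mul_deriv_sub_lt_legendreAt_sub {f : ℝ → ℝ} (hf : ContDiff ℝ 2 f)
    (hmono : StrictMono (deriv f)) {z v : ℝ} (hzv : z ≠ v) :
    z * (deriv f v - deriv f z) < legendreAt f v - legendreAt f z := by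
  have hc := hmono.strictConvexOn_univ_of_deriv hf.continuous
  have hd := (hf.differentiable two_ne_zero v)
  unfold legendreAt
  rcases lt_or_gt_of_ne hzv with h | h
  · have := hc.slope_lt_of_hasDerivAt (mem_univ z) (mem_univ v) h hd.hasDerivAt
    rw [slope_def_field, div_lt_iff₀ (sub_pos.2 h)] at this
    linarith
  · have := hc.lt_slope_of_hasDerivAt (mem_univ v) (mem_univ z) h hd.hasDerivAt
    rw [slope_def_field, lt_div_iff₀ (sub_pos.2 h)] at this
    linarith

lemma mul_deriv_sub_le_legendreAt_sub {f : ℝ → ℝ} (hf : ContDiff ℝ 2 f)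
    (hmono : StrictMono (deriv f)) (z v : ℝ) :
    z * (deriv f v - deriv f z) ≤ legendreAt f v - legendreAt f z := by
  rcases eq_or_ne z v with rfl | h
  · simp
  · exact (mul_deriv_sub_lt_legendreAt_sub hf hmono h).le

/-- Change of variables turning the maximized functional into a Hopf–Lax cost. -/
lemma mul_integral_deriv2_eq {f p P : ℝ → ℝ} (hf : ContDiff ℝ 2 f)
    (hconv : ∀ u, 0 ≤ deriv (deriv f) u) (hp : ∀ a b, IntervalIntegrable p volume a b)
    (hP : ∀ a b, ∫ y in a..b, p y = P b - P a) {c : ℝ} (hc : 0 < c) (x v : ℝ) :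
    c * (∫ s in (0:ℝ)..v, deriv (deriv f) s * (p (x - c * deriv f s) - s)) =
      hopfLaxCost f P c x 0 - hopfLaxCost f P c x v := by
  have hF : ∀ s, HasDerivAt (fun s => x - c * deriv f s) (-(c * deriv (deriv f) s)) s := fun s =>
    ((hf.hasDerivAt_deriv_of_two s).const_mul c).const_sub x
  have hFc : ContinuousOn (fun s => x - c * deriv f s) (uIcc 0 v) := fun s _ =>
    (hF s).continuousAt.continuousWithinAt
  have hneg : ∀ s, -(c * deriv (deriv f) s) ≤ 0 := fun s =>
    neg_nonpos.2 (mul_nonneg hc.le (hconv s))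
  have hint := (intervalIntegral.integrable_comp_mul_deriv_iff_of_deriv_nonpos (g := p) hFc
    (fun s _ => hF s) (fun s _ => hneg s)).2 (hp _ _)
  have hcov := intervalIntegral.integral_comp_mul_deriv_of_deriv_nonpos (g := p) hFc
    (fun s _ => hF s) (fun s _ => hneg s)
  have hgi : IntervalIntegrable (fun s => s * deriv (deriv f) s) volume 0 v :=
    (continuous_id.mul hf.continuous_deriv_deriv_of_two).intervalIntegrable _ _
  have hg := intervalIntegral.integral_eq_sub_of_hasDerivAt
    (fun s (_ : s ∈ uIcc 0 v) => hasDerivAt_legendreAt hf s) hgi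
  have hsplit := intervalIntegral.integral_sub hint.neg (hgi.const_mul c)
  rw [← intervalIntegral.integral_const_mul]
  have hcongr : (∫ s in (0:ℝ)..v, c * (deriv (deriv f) s * (p (x - c * deriv f s) - s))) =
      ∫ s in (0:ℝ)..v, (-fun s => (p ∘ fun s => x - c * deriv f s) s *
        -(c * deriv (deriv f) s)) s - c * (s * deriv (deriv f) s) := by
    refine intervalIntegral.integral_congr fun s _ => ?_
    simp only [Pi.neg_apply, Function.comp_apply]
    ring
  rw [hcongr, hsplit, intervalIntegral.integral_const_mul, hg]
  simp only [Pi.neg_apply]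
  rw [intervalIntegral.integral_neg, hcov, hP]
  unfold hopfLaxCost
  ring

/-- At a point of differentiability, the Hopf–Lax value function has the minimizer as derivative. -/
lemma eq_of_hasDerivAt_value {f P W : ℝ → ℝ} (hf : ContDiff ℝ 2 f) (hmono : StrictMono (deriv f))
    {c : ℝ} (hc : 0 < c) (hle : ∀ y v, W y ≤ hopfLaxCost f P c y v) {y u d : ℝ}
    (hu : W y = hopfLaxCost f P c y u) (hd : HasDerivAt W d y) : d = u := by
  have hcont := hf.continuous_deriv one_le_two
  set Y : ℝ → ℝ := fun v => y + c * (deriv f v - deriv f u) with hY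
  have hYc : Continuous Y := by fun_prop
  have hYu : Y u = y := by simp [hY]
  have hYinj : ∀ v, v ≠ u → Y v ≠ y := by
    intro v hv h
    have h' : c * (deriv f v - deriv f u) = 0 := by simpa [hY] using h
    rcases mul_eq_zero.1 h' with h0 | h0
    · exact hc.ne' h0
    · exact hv (hmono.injective (sub_eq_zero.1 h0))
  have hkey : ∀ v, W (Y v) - W y ≤ v * (Y v - y) := by
    intro v
    have h1 := hle (Y v) v
    have h2 : Y v - c * deriv f v = y - c * deriv f u := by simp only [hY]; ring
    have h3 := mul_le_mul_of_nonneg_left (mul_deriv_sub_le_legendreAt_sub hf hmono v u) hc.le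
    have h4 : v * (Y v - y) = -(c * (v * (deriv f u - deriv f v))) := by simp only [hY]; ring
    unfold hopfLaxCost at h1 hu
    rw [h2] at h1
    linarith
  have hslope : Tendsto (fun v => slope W y (Y v)) (nhdsWithin u {u}ᶜ) (nhds d) := by
    refine (hasDerivAt_iff_tendsto_slope.1 hd).comp (tendsto_nhdsWithin_iff.2 ⟨?_, ?_⟩)
    · exact (hYu ▸ hYc.tendsto u).mono_left nhdsWithin_le_nhds
    · filter_upwards [self_mem_nhdsWithin] with v hv
      exact hYinj v hv
  have hid : Tendsto (fun v : ℝ => v) (nhds u) (nhds u) := tendsto_id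
  apply le_antisymm
  · refine le_of_tendsto_of_tendsto
      (hslope.mono_left (nhdsWithin_mono u (t := {u}ᶜ) (s := Ioi u) fun v hv => ne_of_gt hv))
      (hid.mono_left nhdsWithin_le_nhds) ?_
    filter_upwards [self_mem_nhdsWithin] with v hv
    have hpos : 0 < Y v - y := by
      have := mul_pos hc (sub_pos.2 (hmono hv))
      simp only [hY]; linarith
    rw [slope_def_field, div_le_iff₀ hpos]
    exact hkey v
  · refine le_of_tendsto_of_tendsto (hid.mono_left nhdsWithin_le_nhds)
      (hslope.mono_left (nhdsWithin_mono u (t := {u}ᶜ) (s := Iio u) fun v hv => ne_of_lt hv)) ?_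
    filter_upwards [self_mem_nhdsWithin] with v hv
    have hneg : Y v - y < 0 := by
      have := mul_pos hc (sub_pos.2 (hmono hv))
      simp only [hY]; linarith
    rw [slope_def_field, le_div_iff_of_neg hneg]
    exact hkey v

/-- Two consecutive steps cost at least as much as a suitable single one, strictly more when the
two speeds differ. -/
lemma exists_hopfLaxCost_le {f P : ℝ → ℝ} (hf : ContDiff ℝ 2 f) (hmono : StrictMono (deriv f))
    {c τ : ℝ} (hc : 0 < c) (hτ : 0 < τ) (x v w : ℝ) :
    ∃ z, (c + τ) * deriv f z = c * deriv f v + τ * deriv f w ∧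
      hopfLaxCost f P (c + τ) x z ≤
        hopfLaxCost f P τ (x - c * deriv f v) w + c * legendreAt f v ∧
      (v ≠ w → hopfLaxCost f P (c + τ) x z <
        hopfLaxCost f P τ (x - c * deriv f v) w + c * legendreAt f v) := by
  have hcont := hf.continuous_deriv one_le_two
  have hs : 0 < c + τ := by positivity
  have hmem : (c * deriv f v + τ * deriv f w) / (c + τ) ∈ uIcc (deriv f v) (deriv f w) := by
    rw [mem_uIcc, div_le_iff₀ hs, div_le_iff₀ hs, le_div_iff₀ hs, le_div_iff₀ hs]
    rcases le_total (deriv f v) (deriv f w) with h | h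
    · left; constructor <;> nlinarith
    · right; constructor <;> nlinarith
  obtain ⟨z, -, hz⟩ := intermediate_value_uIcc hcont.continuousOn hmem
  have hz' : (c + τ) * deriv f z = c * deriv f v + τ * deriv f w := by
    rw [hz]; field_simp
  have harg : x - c * deriv f v - τ * deriv f w = x - (c + τ) * deriv f z := by
    rw [hz']; ring
  have hbal : c * (z * (deriv f v - deriv f z)) + τ * (z * (deriv f w - deriv f z)) = 0 := by
    linear_combination -z * hz'
  have hv := mul_le_mul_of_nonneg_left (mul_deriv_sub_le_legendreAt_sub hf hmono z v) hc.le
  have hw := mul_le_mul_of_nonneg_left (mul_deriv_sub_le_legendreAt_sub hf hmono z w) hτ.le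
  refine ⟨z, hz', ?_, fun hvw => ?_⟩
  · unfold hopfLaxCost
    rw [harg]
    linarith
  · unfold hopfLaxCost
    rw [harg]
    rcases eq_or_ne z v with rfl | hzv
    · have := mul_lt_mul_of_pos_left (mul_deriv_sub_lt_legendreAt_sub hf hmono hvw) hτ
      linarith
    · have := mul_lt_mul_of_pos_left (mul_deriv_sub_lt_legendreAt_sub hf hmono hzv) hc
      linarith

/-- Semigroup property of the Hopf–Lax formula at the level of minimizers. -/
lemma hopfLaxCost_minimizers_eq {f P W : ℝ → ℝ} (hf : ContDiff ℝ 2 f)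
    (hmono : StrictMono (deriv f)) {c τ : ℝ} (hc : 0 < c) (hτ : 0 < τ)
    (hle : ∀ y v, W y ≤ hopfLaxCost f P τ y v) (hex : ∀ y, ∃ u, W y = hopfLaxCost f P τ y u)
    (x : ℝ) :
    {w | ∀ v, hopfLaxCost f W c x w ≤ hopfLaxCost f W c x v} =
      {w | ∀ v, hopfLaxCost f P (c + τ) x w ≤ hopfLaxCost f P (c + τ) x v} := by
  have hWP : ∀ z, hopfLaxCost f W c x z ≤ hopfLaxCost f P (c + τ) x z := by
    intro z
    have h := hle (x - c * deriv f z) z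
    have harg : x - c * deriv f z - τ * deriv f z = x - (c + τ) * deriv f z := by ring
    unfold hopfLaxCost at h ⊢
    rw [harg] at h
    linarith
  ext v
  refine ⟨fun hv v' => ?_, fun hv v' => ?_⟩
  · obtain ⟨w, hw⟩ := hex (x - c * deriv f v)
    obtain ⟨z, hz, hz_le, hz_lt⟩ := exists_hopfLaxCost_le (P := P) hf hmono hc hτ x v w
    rw [← hw] at hz_le hz_lt
    change _ ≤ hopfLaxCost f W c x v at hz_le
    change _ → _ < hopfLaxCost f W c x v at hz_lt
    have hvw : v = w := by
      by_contra hne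
      exact absurd ((hv z).trans (hWP z)) (not_le.2 (hz_lt hne))
    subst hvw
    have hzv : z = v := hmono.injective <| mul_left_cancel₀ (add_pos hc hτ).ne' (by rw [hz]; ring)
    subst hzv
    exact hz_le.trans ((hv v').trans (hWP v'))
  · obtain ⟨w, hw⟩ := hex (x - c * deriv f v')
    obtain ⟨z, -, hz_le, -⟩ := exists_hopfLaxCost_le (P := P) hf hmono hc hτ x v' w
    rw [← hw] at hz_le
    exact (hWP v).trans ((hv z).trans hz_le)

lemma exists_hopfLaxCost_lt {f P : ℝ → ℝ} (hf : ContDiff ℝ 2 f) (hmono : StrictMono (deriv f))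
    {M c : ℝ} (hM : 0 ≤ M) (hP : ∀ a b, |P b - P a| ≤ M * |b - a|) (hc : 0 < c) (x : ℝ) {w : ℝ}
    (hw : w ∉ Icc (-M) M) :
    ∃ m ∈ Icc (-M) M, hopfLaxCost f P c x m < hopfLaxCost f P c x w := by
  rcases lt_or_ge w (-M) with h | h
  · refine ⟨-M, ⟨le_rfl, by linarith⟩, ?_⟩
    have h1 := mul_lt_mul_of_pos_left (mul_deriv_sub_lt_legendreAt_sub hf hmono h.ne') hc
    have h3 := hP (x - c * deriv f w) (x - c * deriv f (-M))
    have h4 := mul_pos hc (sub_pos.2 (hmono h))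
    rw [show x - c * deriv f (-M) - (x - c * deriv f w) = -(c * (deriv f (-M) - deriv f w)) by ring,
      abs_neg, abs_of_pos h4] at h3
    have h5 := (abs_le.1 h3).2
    unfold hopfLaxCost
    linarith
  · have h : M < w := not_le.1 fun h' => hw ⟨h, h'⟩
    refine ⟨M, ⟨by linarith, le_rfl⟩, ?_⟩
    have h1 := mul_lt_mul_of_pos_left (mul_deriv_sub_lt_legendreAt_sub hf hmono h.ne) hc
    have h3 := hP (x - c * deriv f w) (x - c * deriv f M)
    have h4 := mul_pos hc (sub_pos.2 (hmono h))
    rw [show x - c * deriv f M - (x - c * deriv f w) = c * (deriv f w - deriv f M) by ring,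
      abs_of_pos h4] at h3
    have h5 := (abs_le.1 h3).2
    unfold hopfLaxCost
    linarith

lemma sInf_hopfLaxCost_minimizers_mem {f P : ℝ → ℝ} (hf : ContDiff ℝ 2 f)
    (hmono : StrictMono (deriv f)) {M c : ℝ} (hM : 0 ≤ M) (hPc : Continuous P)
    (hP : ∀ a b, |P b - P a| ≤ M * |b - a|) (hc : 0 < c) (x v : ℝ) :
    hopfLaxCost f P c x
        (sInf {w | ∀ v, hopfLaxCost f P c x w ≤ hopfLaxCost f P c x v}) ≤
      hopfLaxCost f P c x v := by
  have hac := hf.continuous_deriv one_le_two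
  have hfc := hf.continuous
  have hcont : Continuous (hopfLaxCost f P c x) := by
    unfold hopfLaxCost legendreAt
    fun_prop
  set S := {w | ∀ v, hopfLaxCost f P c x w ≤ hopfLaxCost f P c x v} with hS
  have hclosed : IsClosed S := by
    rw [hS, ofPred_forall]
    exact isClosed_iInter fun v => isClosed_le hcont continuous_const
  have hbdd : BddBelow S := by
    refine ⟨-M, fun w hw => ?_⟩
    by_contra h
    obtain ⟨m, -, hm⟩ := exists_hopfLaxCost_lt hf hmono hM hP hc x (w := w) fun h' => h h'.1
    exact (hw m).not_gt hm
  have hne : S.Nonempty := by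
    obtain ⟨u, -, hu⟩ := (isCompact_Icc (a := -M) (b := M)).exists_isMinOn
      ⟨0, by constructor <;> linarith⟩ hcont.continuousOn
    refine ⟨u, fun v => ?_⟩
    by_cases hv : v ∈ Icc (-M) M
    · exact hu hv
    · obtain ⟨m, hm, hmv⟩ := exists_hopfLaxCost_lt hf hmono hM hP hc x hv
      exact (hu hm).trans hmv.le
  exact hclosed.csInf_mem hne hbdd v

lemma abs_value_sub_le {f P W u : ℝ → ℝ} {M c : ℝ} (hP : ∀ a b, |P b - P a| ≤ M * |b - a|)
    (hle : ∀ y v, W y ≤ hopfLaxCost f P c y v) (hu : ∀ y, W y = hopfLaxCost f P c y (u y))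
    (a b : ℝ) : |W b - W a| ≤ M * |b - a| := by
  have key : ∀ a b, W b - W a ≤ M * |b - a| := by
    intro a b
    have h1 := hle b (u a)
    have h2 := hu a
    have h3 := (abs_le.1 (hP (a - c * deriv f (u a)) (b - c * deriv f (u a)))).2
    rw [sub_sub_sub_cancel_right] at h3
    unfold hopfLaxCost at h1 h2
    linarith
  refine abs_le.2 ⟨?_, key a b⟩
  have := key b a
  rw [abs_sub_comm] at this
  linarith

/-- The value function of the Hopf–Lax formula is a primitive of any selection of minimizers. -/
lemma intervalIntegrable_and_integral_eq_value_sub {f P W u : ℝ → ℝ} (hf : ContDiff ℝ 2 f)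
    (hmono : StrictMono (deriv f)) {M c : ℝ} (hM : 0 ≤ M) (hc : 0 < c)
    (hP : ∀ a b, |P b - P a| ≤ M * |b - a|)
    (hle : ∀ y v, W y ≤ hopfLaxCost f P c y v) (hu : ∀ y, W y = hopfLaxCost f P c y (u y))
    (a b : ℝ) : IntervalIntegrable u volume a b ∧ ∫ y in a..b, u y = W b - W a := by
  have hLip : LipschitzWith M.toNNReal W := LipschitzWith.of_dist_le_mul fun y y' => by
    rw [Real.coe_toNNReal M hM, Real.dist_eq, Real.dist_eq]
    exact abs_value_sub_le hP hle hu y' y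
  have hae : deriv W =ᵐ[volume] u := by
    filter_upwards [hLip.ae_differentiableAt_real] with y hy
    exact eq_of_hasDerivAt_value hf hmono hc hle (hu y) hy.hasDerivAt
  have hAC : AbsolutelyContinuousOnInterval W a b :=
    (hLip.lipschitzOnWith (s := uIcc a b)).absolutelyContinuousOnInterval
  refine ⟨hAC.intervalIntegrable_deriv.congr_ae (ae_restrict_of_ae hae), ?_⟩
  rw [← hAC.integral_deriv_eq_sub]
  exact intervalIntegral.integral_congr_ae (hae.mono fun y hy _ => hy.symm)

/-- refined semigroup property: restarting the formula at time `τ` from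
the profile `u⁺(·,τ)` reproduces the same maximizer sets, hence the same solution. -/
theorem stmt9_refined_semigroup
    (f φ : ℝ → ℝ) (M : ℝ)
    (hf : ContDiff ℝ 2 f)
    (hconv : ∀ u : ℝ, 0 ≤ deriv (deriv f) u)
    (hdeg : volume {u : ℝ | deriv (deriv f) u = 0} = 0)
    (hφmeas : Measurable φ)
    (hφbdd : ∀ x : ℝ, |φ x| ≤ M)
    (τ : ℝ) (hτ : 0 < τ) :
    ∀ x t : ℝ, τ < t →
      maxSetTau f φ τ x t = maxSet f φ x t ∧
      sSup (maxSetTau f φ τ x t) = uMinus f φ x t ∧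
      sInf (maxSetTau f φ τ x t) = uPlus f φ x t := by
  have hmono := strictMono_deriv_of_deriv2_nonneg hf hconv hdeg
  have hM : 0 ≤ M := (abs_nonneg _).trans (hφbdd 0)
  have hφint : ∀ a b, IntervalIntegrable φ volume a b := fun a b =>
    (intervalIntegrable_const (c := M)).mono_fun hφmeas.aestronglyMeasurable
      (Eventually.of_forall fun y => by
        simpa [Real.norm_eq_abs] using (hφbdd y).trans (le_abs_self M))
  set P : ℝ → ℝ := fun y => ∫ s in (0:ℝ)..y, φ s with hPdef
  have hPsub : ∀ a b, ∫ y in a..b, φ y = P b - P a := fun a b =>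
    (intervalIntegral.integral_interval_sub_left (hφint 0 b) (hφint 0 a)).symm
  have hP : ∀ a b, |P b - P a| ≤ M * |b - a| := fun a b => by
    rw [← hPsub]
    exact intervalIntegral.norm_integral_le_of_norm_le_const (f := φ) fun y _ => hφbdd y
  have hPc : Continuous P := intervalIntegral.continuous_primitive hφint 0
  have hmax : ∀ x t, 0 < t →
      maxSet f φ x t = {w | ∀ v, hopfLaxCost f P t x w ≤ hopfLaxCost f P t x v} := by
    intro x t ht
    simp only [maxSet, eFun, mul_integral_deriv2_eq hf hconv hφint hPsub ht, sub_le_sub_iff_left]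
  set u : ℝ → ℝ := fun y => uPlus f φ y τ with hu
  set W : ℝ → ℝ := fun y => hopfLaxCost f P τ y (u y) with hW
  have hle : ∀ y v, W y ≤ hopfLaxCost f P τ y v := by
    intro y v
    simp only [hW, hu, uPlus, hmax y τ hτ]
    exact sInf_hopfLaxCost_minimizers_mem hf hmono hM hPc hP hτ y v
  have hWint := intervalIntegrable_and_integral_eq_value_sub hf hmono hM hτ hP hle fun _ => rfl
  intro x t ht
  have hc : 0 < t - τ := sub_pos.2 ht
  have hmain : maxSetTau f φ τ x t = maxSet f φ x t := by
    have heq := hopfLaxCost_minimizers_eq hf hmono hc hτ hle (fun y => ⟨u y, rfl⟩) x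
    rw [sub_add_cancel] at heq
    rw [hmax x t (hτ.trans ht), ← heq]
    have hE : ∀ v, eTau f φ τ v x t =
        hopfLaxCost f W (t - τ) x 0 - hopfLaxCost f W (t - τ) x v := fun v =>
      mul_integral_deriv2_eq hf hconv (fun a b => (hWint a b).1) (fun a b => (hWint a b).2) hc x v
    simp only [maxSetTau, hE, sub_le_sub_iff_left]
  exact ⟨hmain, by rw [hmain, uMinus], by rw [hmain, uPlus]⟩
end
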